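/- arXiv:math/0304077 — 2 statements merged into one kernel-verified Lean document; each statement's English description precedes it below -/
import Mathlib

section
/- Let A, A* ∈ Mat_{d+1}(K) with A lower bidiagonal and A* upper bidiagonal. Then A, A* is a Leonard pair in Mat_{d+1}(K) if and only if there exists a parameter array (θ_i, θ*_i, i=0..d; φ_j, φ'_j, j=1..d) over K such that A_{ii} = θ_i and A*_{ii} = θ*_i for 0 ≤ i ≤ d and A_{i,i-1} A*_{i-1,i} = φ_i for 1 ≤ i ≤ d. -/
open Polynomial Matrix Finset

variable {K : Type*} [Field K]

/-- The primitive idempotent of `A` associated with eigenvalue `θ i`: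
`E i = ∏_{j ≠ i} (A - θ j • 1) / (θ i - θ j)`. -/
noncomputable def primIdem {d : ℕ} (A : Matrix (Fin (d + 1)) (Fin (d + 1)) K)
    (θ : Fin (d + 1) → K) (i : Fin (d + 1)) : Matrix (Fin (d + 1)) (Fin (d + 1)) K :=
  Polynomial.aeval A
    (∏ j ∈ Finset.univ.erase i,
      (Polynomial.C (θ i - θ j)⁻¹ * (Polynomial.X - Polynomial.C (θ j))))

/-- `A` is multiplicity-free with (distinct) eigenvalues `θ 0, …, θ d`. -/
def MultFreeWith {d : ℕ} (A : Matrix (Fin (d + 1)) (Fin (d + 1)) K)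
    (θ : Fin (d + 1) → K) : Prop :=
  Function.Injective θ ∧ A.charpoly = ∏ i, (Polynomial.X - Polynomial.C (θ i))

/-- `θ` is an eigenvalue sequence for the (ordered) pair `A, B`: the corresponding
ordering of the primitive idempotents of `A` is an idempotent sequence for `A, B`. -/
def IsEigenvalueSeq {d : ℕ} (A B : Matrix (Fin (d + 1)) (Fin (d + 1)) K)
    (θ : Fin (d + 1) → K) : Prop :=
  MultFreeWith A θ ∧
    ∀ i j : Fin (d + 1),
      (1 < |((i : ℕ) : ℤ) - ((j : ℕ) : ℤ)| → primIdem A θ i * B * primIdem A θ j = 0) ∧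
      (|((i : ℕ) : ℤ) - ((j : ℕ) : ℤ)| = 1 → primIdem A θ i * B * primIdem A θ j ≠ 0)

/-- `A, B` is a Leonard pair in `Mat_{d+1}(K)`. -/
def IsLeonardPair {d : ℕ} (A B : Matrix (Fin (d + 1)) (Fin (d + 1)) K) : Prop :=
  (∃ θ, IsEigenvalueSeq A B θ) ∧ (∃ θs, IsEigenvalueSeq B A θs)

/-- Every nonzero entry lies on the diagonal or the subdiagonal. -/
def LowerBidiagonal {K : Type*} [Field K] {d : ℕ}
    (A : Matrix (Fin (d + 1)) (Fin (d + 1)) K) : Prop :=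
  ∀ i j : Fin (d + 1), (i : ℕ) ≠ (j : ℕ) → (i : ℕ) ≠ (j : ℕ) + 1 → A i j = 0

/-- Every nonzero entry lies on the diagonal or the superdiagonal. -/
def UpperBidiagonal {K : Type*} [Field K] {d : ℕ}
    (A : Matrix (Fin (d + 1)) (Fin (d + 1)) K) : Prop :=
  ∀ i j : Fin (d + 1), (i : ℕ) ≠ (j : ℕ) → (j : ℕ) ≠ (i : ℕ) + 1 → A i j = 0

/-- Every nonzero entry lies on the diagonal, subdiagonal, or superdiagonal. -/
def Tridiagonal {K : Type*} [Field K] {d : ℕ}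
    (A : Matrix (Fin (d + 1)) (Fin (d + 1)) K) : Prop :=
  ∀ i j : Fin (d + 1), 1 < |((i : ℕ) : ℤ) - ((j : ℕ) : ℤ)| → A i j = 0

/-- A parameter array of diameter `d` over `K`:
scalars `θ 0,…,θ d`, `θs 0,…,θs d`, `φ 1,…,φ d`, `φp 1,…,φp d`
satisfying conditions (i)–(v) of the classification theorem. -/
def IsParameterArray (K : Type*) [Field K] (d : ℕ) (θ θs φ φp : ℕ → K) : Prop :=
  (∀ i, 1 ≤ i → i ≤ d → φ i ≠ 0 ∧ φp i ≠ 0) ∧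
  (∀ i j, i ≤ d → j ≤ d → i ≠ j → θ i ≠ θ j ∧ θs i ≠ θs j) ∧
  (∀ i, 1 ≤ i → i ≤ d →
    φ i = φp 1 * (∑ h ∈ Finset.range i, (θ h - θ (d - h)) / (θ 0 - θ d))
      + (θs i - θs 0) * (θ (i - 1) - θ d)) ∧
  (∀ i, 1 ≤ i → i ≤ d →
    φp i = φ 1 * (∑ h ∈ Finset.range i, (θ h - θ (d - h)) / (θ 0 - θ d))
      + (θs i - θs 0) * (θ (d - i + 1) - θ 0)) ∧
  (∃ β : K, ∀ i, 2 ≤ i → i + 1 ≤ d →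
    (θ (i - 2) - θ (i + 1)) / (θ (i - 1) - θ i) = β ∧
    (θs (i - 2) - θs (i + 1)) / (θs (i - 1) - θs i) = β)

/-- the Askey-Wilson quadratic -/
def lpP (β γ ρ x y : K) : K := x ^ 2 - β * x * y + y ^ 2 - γ * (x + y) - ρ

def lpE2 (β γ t0 t1 t2 s0 s1 s2 p0 p1 p2 p3 : K) : K :=
  p0 - (β + 1) * p1 + (β + 1) * p2 - p3 + s0 * (t0 + t1 - β * t0 - γ) + s1 * (t0 - t2)
    - s2 * (t1 + t2 - β * t2 - γ) + (s0 - β * s1 + s2) * (t2 - t0)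

def lpR {V : Type*} [AddCommGroup V] [Module K V] (A B : V →ₗ[K] V) (β γ ρ : K) : V →ₗ[K] V :=
  A * A * A * B - (β + 1) • (A * A * B * A) + (β + 1) • (A * B * A * A) - B * A * A * A
    - γ • (A * A * B - B * A * A) - ρ • (A * B - B * A)

theorem lp_core {V : Type*} [AddCommGroup V] [Module K V] (A B : V →ₗ[K] V) (β γ ρ : K)
    (m x y z w : V) (tm t0 t1 t2 s0 s1 s2 p0 p1 p2 : K)
    (hx : A x = t0 • x + y) (hy : A y = t1 • y + z) (hz : A z = t2 • z + w)
    (bx : B x = s0 • x + p0 • m) (by' : B y = s1 • y + p1 • x) (bz : B z = s2 • z + p2 • y)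
    (hm : p0 = 0 ∨ (A m = tm • m + x ∧ lpP β γ ρ tm t0 = 0 ∧ tm - β * t0 + t1 = γ))
    (h01 : lpP β γ ρ t0 t1 = 0) (h12 : lpP β γ ρ t1 t2 = 0) (hg : t0 - β * t1 + t2 = γ) :
    lpR A B β γ ρ x = (s0 - (β + 1) * s1 + (β + 1) * s2) • w
      + lpE2 β γ t0 t1 t2 s0 s1 s2 p0 p1 p2 0 • z - B w := by
  unfold lpR lpE2
  unfold lpP at *
  have hρ : ρ = t0 ^ 2 - β * t0 * t1 + t1 ^ 2 - γ * (t0 + t1) := by linear_combination -h01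
  rcases hm with rfl | ⟨am, hmP, hmg⟩
  · simp only [LinearMap.sub_apply, LinearMap.add_apply, LinearMap.smul_apply, Module.End.mul_apply,
      hx, hy, hz, bx, by', bz, map_add, map_smul, zero_smul, add_zero]
    subst hρ
    subst hg
    match_scalars <;> ring
  · simp only [LinearMap.sub_apply, LinearMap.add_apply, LinearMap.smul_apply, Module.End.mul_apply,
      hx, hy, hz, bx, by', bz, am, map_add, map_smul]
    have ht2 : t2 = γ + β * t1 - t0 := by linear_combination hg
    have htm : γ = tm - β * t0 + t1 := hmg.symm
    subst hρ
    subst ht2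
    subst htm
    match_scalars <;> ring

/-- two families on which `A` acts by raising -/
def lpSpl {V : Type*} [AddCommGroup V] [Module K V] (A B : V →ₗ[K] V) (d : ℕ) (θ θs φ : ℕ → K)
    (e : ℕ → V) : Prop :=
  (∀ i, i < d → A (e i) = θ i • e i + e (i + 1)) ∧ B (e 0) = θs 0 • e 0 ∧
    ∀ i, i < d → B (e (i + 1)) = θs (i + 1) • e (i + 1) + φ (i + 1) • e i

def lpAW (β γ ρ : K) (d : ℕ) (θ : ℕ → K) : Prop :=
  (∀ i, i + 1 ≤ d → lpP β γ ρ (θ i) (θ (i + 1)) = 0) ∧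
  (∀ i, i + 2 ≤ d → θ i - β * θ (i + 1) + θ (i + 2) = γ)

theorem lpAW_rev {β γ ρ : K} {d : ℕ} {θ : ℕ → K} (h : lpAW β γ ρ d θ) :
    lpAW β γ ρ d (fun i => θ (d - i)) := by
  refine ⟨fun i hi => ?_, fun i hi => ?_⟩
  · have := h.1 (d - (i + 1)) (by omega)
    rw [show d - (i + 1) + 1 = d - i by omega] at this
    unfold lpP at *
    linear_combination this
  · have := h.2 (d - (i + 2)) (by omega)
    rw [show d - (i + 2) + 1 = d - (i + 1) by omega, show d - (i + 2) + 2 = d - i by omega] at this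
    linear_combination this

/-- core computation along a split family -/
theorem lp_coreSpl {V : Type*} [AddCommGroup V] [Module K V] (A B : V →ₗ[K] V) {β γ ρ : K}
    {d : ℕ} {θ θs φ : ℕ → K} {e : ℕ → V} (hφ0 : φ 0 = 0)
    (hA : ∀ i, i < d → A (e i) = θ i • e i + e (i + 1)) (hθ : lpAW β γ ρ d θ)
    (i : ℕ) (hi : i + 3 ≤ d)
    (hB0 : B (e 0) = θs 0 • e 0)
    (hB : ∀ j, j < i + 2 → B (e (j + 1)) = θs (j + 1) • e (j + 1) + φ (j + 1) • e j) :
    lpR A B β γ ρ (e i) = (θs i - (β + 1) * θs (i + 1) + (β + 1) * θs (i + 2)) • e (i + 3)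
      + lpE2 β γ (θ i) (θ (i + 1)) (θ (i + 2)) (θs i) (θs (i + 1)) (θs (i + 2))
          (φ i) (φ (i + 1)) (φ (i + 2)) 0 • e (i + 2) - B (e (i + 3)) := by
  have h01 := hθ.1 i (by omega)
  have h12 := hθ.1 (i + 1) (by omega)
  have hg := hθ.2 i (by omega)
  rcases i with _ | k
  · refine lp_core A B β γ ρ 0 _ _ _ _ 0 _ _ _ _ _ _ _ _ _ (hA 0 (by omega)) (hA 1 (by omega))
      (hA 2 (by omega)) ?_ (hB 0 (by omega)) (hB 1 (by omega)) (Or.inl hφ0) h01 h12 hg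
    rw [hB0]; simp
  · exact lp_core A B β γ ρ (e k) _ _ _ _ (θ k) _ _ _ _ _ _ _ _ _ (hA _ (by omega))
      (hA _ (by omega)) (hA _ (by omega)) (hB k (by omega)) (hB _ (by omega)) (hB _ (by omega))
      (Or.inr ⟨hA k (by omega), hθ.1 k (by omega), hθ.2 k (by omega)⟩) h01 h12 hg

/-- the normalised partial sums -/
def lpS (d : ℕ) (θ : ℕ → K) (i : ℕ) : K :=
  ∑ h ∈ Finset.range i, (θ h - θ (d - h)) / (θ 0 - θ d)

theorem lpS_rev {d : ℕ} {θ : ℕ → K} (i : ℕ) (hi : i ≤ d + 1) :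
    lpS d (fun i => θ (d - i)) i = lpS d θ i := by
  unfold lpS
  refine Finset.sum_congr rfl fun h hh => ?_
  have := Finset.mem_range.1 hh
  simp only [Nat.sub_self, Nat.sub_zero]
  rw [show d - (d - h) = h by omega, ← neg_sub (θ h), ← neg_sub (θ 0), neg_div_neg_eq]

theorem lpE2_formula {β γ ρ : K} {d : ℕ} {θ θs φ : ℕ → K} {C D : K} (hθ : lpAW β γ ρ d θ)
    (i : ℕ) (hi : i + 3 ≤ d)
    (hs : θs i - (β + 1) * θs (i + 1) + (β + 1) * θs (i + 2) - θs (i + 3) = 0)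
    (hφ : ∀ j, j ≤ d → φ j = C * lpS d θ j + (θs j - θs 0) * (θ (j - 1) - D)) :
    lpE2 β γ (θ i) (θ (i + 1)) (θ (i + 2)) (θs i) (θs (i + 1)) (θs (i + 2))
          (φ i) (φ (i + 1)) (φ (i + 2)) (φ (i + 3)) = 0 := by
  have hS : lpS d θ i - (β + 1) * lpS d θ (i + 1) + (β + 1) * lpS d θ (i + 2)
      - lpS d θ (i + 3) = 0 := by
    unfold lpS
    simp only [Finset.sum_range_succ]
    have h1 := hθ.2 i (by omega)
    have h2 := hθ.2 (d - (i + 2)) (by omega)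
    rw [show d - (i + 2) + 1 = d - (i + 1) by omega, show d - (i + 2) + 2 = d - i by omega] at h2
    linear_combination (-h1 + h2) * (θ 0 - θ d)⁻¹
  have hg := hθ.2 i (by omega)
  rw [hφ i (by omega), hφ (i + 1) (by omega), hφ (i + 2) (by omega), hφ (i + 3) (by omega)]
  unfold lpE2
  simp only [Nat.add_sub_cancel, show i + 2 - 1 = i + 1 by omega, show i + 3 - 1 = i + 2 by omega]
  rcases i with _ | k
  · simp only [Nat.zero_add, Nat.zero_sub] at *
    linear_combination C * hS + (-D + θ 2) * hs - (θs 2 - θs 0) * hg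
  · have hg' := hθ.2 k (by omega)
    simp only [Nat.add_sub_cancel]
    linear_combination C * hS + (-D + θ (k + 1 + 2)) * hs - (θs (k + 1 + 2) - θs 0) * hg + (θs (k + 1) - θs 0) * hg'

theorem lp_spanA {V : Type*} [AddCommGroup V] [Module K V] (A : V →ₗ[K] V) {d : ℕ} {θ : ℕ → K}
    {e : ℕ → V} (hA : ∀ i, i < d → A (e i) = θ i • e i + e (i + 1)) (n : ℕ) (hn : n ≤ d) (x : V)
    (hx : x ∈ Submodule.span K (e '' Set.Iio n)) :
    A x ∈ Submodule.span K (e '' Set.Iio (n + 1)) := by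
  induction hx using Submodule.span_induction with
  | mem x hx =>
    obtain ⟨i, hi, rfl⟩ := hx
    simp only [Set.mem_Iio] at hi
    rw [hA i (by omega)]
    refine Submodule.add_mem _ (Submodule.smul_mem _ _ (Submodule.subset_span ⟨i, ?_, rfl⟩))
      (Submodule.subset_span ⟨i + 1, ?_, rfl⟩) <;> simp only [Set.mem_Iio] <;> omega
  | zero => simp
  | add x y _ _ hx hy => rw [map_add]; exact Submodule.add_mem _ hx hy
  | smul a x _ hx => rw [map_smul]; exact Submodule.smul_mem _ _ hx

theorem lp_span {V : Type*} [AddCommGroup V] [Module K V] (A : V →ₗ[K] V) {d : ℕ} {θ θ' : ℕ → K}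
    {e f : ℕ → V} (hA : ∀ i, i < d → A (e i) = θ i • e i + e (i + 1))
    (hA' : ∀ i, i < d → A (f i) = θ' i • f i + f (i + 1)) (h0 : f 0 = e 0) (n : ℕ) (hn : n ≤ d) :
    f n - e n ∈ Submodule.span K (e '' Set.Iio n) := by
  induction n with
  | zero => simp [h0]
  | succ n ih =>
    have ih := ih (by omega)
    have h1 := lp_spanA A hA n (by omega) _ ih
    have hmono : Submodule.span K (e '' Set.Iio n) ≤ Submodule.span K (e '' Set.Iio (n + 1)) :=
      Submodule.span_mono (Set.image_mono (Set.Iio_subset_Iio (by omega)))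
    have h2 := hmono ih
    have h3 : e n ∈ Submodule.span K (e '' Set.Iio (n + 1)) :=
      Submodule.subset_span ⟨n, by simp, rfl⟩
    have : f (n + 1) - e (n + 1) = A (f n - e n) - θ' n • (f n - e n) + (θ n - θ' n) • e n := by
      rw [map_sub, hA n (by omega), hA' n (by omega)]; module
    rw [this]
    exact Submodule.add_mem _ (Submodule.sub_mem _ h1 (Submodule.smul_mem _ _ h2))
      (Submodule.smul_mem _ _ h3)

theorem lp_span_mem {V : Type*} [AddCommGroup V] [Module K V] (A : V →ₗ[K] V) {d : ℕ}
    {θ θ' : ℕ → K}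
    {e f : ℕ → V} (hA : ∀ i, i < d → A (e i) = θ i • e i + e (i + 1))
    (hA' : ∀ i, i < d → A (f i) = θ' i • f i + f (i + 1)) (h0 : f 0 = e 0) (n : ℕ) (hn : n ≤ d) :
    f n ∈ Submodule.span K (e '' Set.Iio (n + 1)) := by
  have h1 := lp_span A hA hA' h0 n hn
  have hmono : Submodule.span K (e '' Set.Iio n) ≤ Submodule.span K (e '' Set.Iio (n + 1)) :=
    Submodule.span_mono (Set.image_mono (Set.Iio_subset_Iio (by omega)))
  have h3 : e n ∈ Submodule.span K (e '' Set.Iio (n + 1)) :=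
    Submodule.subset_span ⟨n, by simp, rfl⟩
  simpa using Submodule.add_mem _ (hmono h1) h3

theorem lp_span_le {V : Type*} [AddCommGroup V] [Module K V] (A : V →ₗ[K] V) {d : ℕ}
    {θ θ' : ℕ → K}
    {e f : ℕ → V} (hA : ∀ i, i < d → A (e i) = θ i • e i + e (i + 1))
    (hA' : ∀ i, i < d → A (f i) = θ' i • f i + f (i + 1)) (h0 : f 0 = e 0) (n : ℕ)
    (hn : n ≤ d + 1) :
    Submodule.span K (f '' Set.Iio n) ≤ Submodule.span K (e '' Set.Iio n) := by
  rw [Submodule.span_le]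
  rintro _ ⟨i, hi, rfl⟩
  simp only [Set.mem_Iio] at hi
  have := lp_span_mem A hA hA' h0 i (by omega)
  exact Submodule.span_mono (Set.image_mono (Set.Iio_subset_Iio (by omega))) this

theorem lp_G {V : Type*} [AddCommGroup V] [Module K V] (A B : V →ₗ[K] V) {d : ℕ}
    {θ θs φ φp : ℕ → K} {e f : ℕ → V} (he : lpSpl A B d θ θs φ e)
    (hf0 : f 0 = e 0) (hf : ∀ i, i < d → A (f i) = θ (d - i) • f i + f (i + 1))
    (hd : 1 ≤ d → θ 0 ≠ θ d)
    (hφ : ∀ j, j ≤ d → φ j = φp 1 * lpS d θ j + (θs j - θs 0) * (θ (j - 1) - θ d))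
    (hφp : ∀ j, j ≤ d → φp j = φ 1 * lpS d θ j + (θs j - θs 0) * (θ (d - (j - 1)) - θ 0))
    (hv : 3 ≤ d → ∃ β γ ρ, lpAW β γ ρ d θ ∧
      ∀ i, i + 3 ≤ d → θs i - (β + 1) * θs (i + 1) + (β + 1) * θs (i + 2) - θs (i + 3) = 0) :
    lpSpl A B d (fun i => θ (d - i)) θs φp f := by
  obtain ⟨heA, heB0, heB⟩ := he
  refine ⟨hf, by rw [hf0, heB0], ?_⟩
  intro i
  induction i using Nat.strong_induction_on with
  | _ i ih =>
  intro hi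
  have hS1 : lpS d θ 1 = 1 := by
    unfold lpS
    simp [div_self (sub_ne_zero.2 (hd (by omega)))]
  have hφ1 := hφ 1 (by omega)
  have hφp1 := hφp 1 (by omega)
  rw [hS1] at hφ1 hφp1
  simp only [Nat.sub_self, Nat.sub_zero] at hφ1 hφp1
  have hf1 : f 1 = e 1 + (θ 0 - θ d) • e 0 := by
    have h1 := hf 0 (by omega)
    rw [hf0, heA 0 (by omega)] at h1
    simp only [Nat.sub_zero, Nat.zero_add] at h1
    rw [sub_smul]
    linear_combination (norm := module) -h1
  match i, ih, hi with
  | 0, _, hi =>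
    simp only [Nat.zero_add]
    rw [hf1, map_add, map_smul, heB 0 hi, heB0, hf0]
    simp only [Nat.zero_add]
    match_scalars
    · ring
    · linear_combination -hφp1
  | 1, _, hi =>
    simp only [Nat.reduceAdd]
    have hS2 : (θ 0 - θ d) * lpS d θ 2 = θ 0 - θ d + θ 1 - θ (d - 1) := by
      unfold lpS
      simp only [Finset.sum_range_succ, Finset.sum_range_zero]
      have := sub_ne_zero.2 (hd (by omega))
      field_simp
      simp
      ring
    have hφ2 := hφ 2 (by omega)
    have hφp2 := hφp 2 (by omega)
    simp only [Nat.add_one_sub_one] at hφ2 hφp2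
    have hf2 : f 2 = e 2 + (θ 0 + θ 1 - θ d - θ (d - 1)) • e 1
        + ((θ 0 - θ d) * (θ 0 - θ (d - 1))) • e 0 := by
      have h1 := hf 1 hi
      rw [hf1, map_add, map_smul, heA 0 (by omega), heA 1 hi] at h1
      simp only [Nat.zero_add, Nat.reduceAdd] at h1
      linear_combination (norm := module) -h1
    rw [hf2, hf1, map_add, map_add, map_smul, map_smul, heB0]
    have hb1 := heB 0 (by omega)
    have hb2 := heB 1 (by omega)
    simp only [Nat.zero_add, Nat.reduceAdd] at hb1 hb2
    rw [hb1, hb2]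
    match_scalars
    · ring
    · linear_combination hφ2 - hφp2 + lpS d θ 2 * hφp1 - (θs 1 - θs 0) * hS2
    · linear_combination  -(θ 0 - θ d) * hφp2 - φ 1 * hS2
  | (k + 2), ih, hi =>
    obtain ⟨β, γ, ρ, hθ, hs⟩ := hv (by omega)
    have hsk := hs k (by omega)
    have hφ0 : φ 0 = 0 := by rw [hφ 0 (by omega)]; simp [lpS]
    have hφp0 : φp 0 = 0 := by rw [hφp 0 (by omega)]; simp [lpS]
    have hRe : ∀ j, j + 3 ≤ d → lpR A B β γ ρ (e j) = 0 := by
      intro j hj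
      rw [lp_coreSpl A B hφ0 heA hθ j hj heB0 (fun l hl => heB l (by omega)), heB (j + 2) (by omega)]
      have hE := lpE2_formula hθ j hj (hs j hj) hφ
      have hsj := hs j hj
      unfold lpE2 at hE ⊢
      linear_combination (norm := module) hE • e (j + 2) + hsj • e (j + 3)
    have hRf : lpR A B β γ ρ (f k) = 0 := by
      have := lp_span_mem A heA hf hf0 k (by omega)
      have hle : Submodule.span K (e '' Set.Iio (k + 1)) ≤ LinearMap.ker (lpR A B β γ ρ) := by
        rw [Submodule.span_le]
        rintro _ ⟨j, hj, rfl⟩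
        simp only [Set.mem_Iio] at hj
        exact hRe j (by omega)
      exact hle this
    have hcore := lp_coreSpl (θ := fun i => θ (d - i)) A B (θs := θs) hφp0 hf (lpAW_rev hθ) k (by omega) (by rw [hf0, heB0])
      (fun l hl => ih l (by omega) (by omega))
    have hE := lpE2_formula (lpAW_rev hθ) k (by omega) hsk (C := φ 1) (D := θ 0) (φ := φp)
      (fun j hj => by rw [lpS_rev j (by omega)]; exact hφp j hj)
    rw [hRf] at hcore
    have hE' : lpE2 β γ (θ (d - k)) (θ (d - (k + 1))) (θ (d - (k + 2))) (θs k) (θs (k + 1))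
      (θs (k + 2)) (φp k) (φp (k + 1)) (φp (k + 2)) 0 = φp (k + 3) := by
      unfold lpE2 at hE ⊢
      linear_combination hE
    simp only [hE'] at hcore
    have hs' : θs k - (β + 1) * θs (k + 1) + (β + 1) * θs (k + 2) = θs (k + 3) := by
      linear_combination hsk
    rw [hs'] at hcore
    exact (sub_eq_zero.1 hcore.symm).symm

theorem lpE2_unique {β γ : K} {d : ℕ} {θ θs φ φ' : ℕ → K}
    (h : ∀ i, i + 3 ≤ d → lpE2 β γ (θ i) (θ (i + 1)) (θ (i + 2)) (θs i) (θs (i + 1)) (θs (i + 2))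
          (φ i) (φ (i + 1)) (φ (i + 2)) (φ (i + 3)) = 0)
    (h' : ∀ i, i + 3 ≤ d → lpE2 β γ (θ i) (θ (i + 1)) (θ (i + 2)) (θs i) (θs (i + 1)) (θs (i + 2))
          (φ' i) (φ' (i + 1)) (φ' (i + 2)) (φ' (i + 3)) = 0)
    (h0 : φ 0 = φ' 0) (h1 : φ 1 = φ' 1) (h2 : φ 2 = φ' 2) :
    ∀ i, i ≤ d → φ i = φ' i := by
  intro i
  induction i using Nat.strong_induction_on with
  | _ i ih =>
  intro hi
  match i, ih, hi with
  | 0, _, _ => exact h0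
  | 1, _, _ => exact h1
  | 2, _, _ => exact h2
  | (k + 3), ih, hi =>
    have a := h k hi
    have b := h' k hi
    have c0 := ih k (by omega) (by omega)
    have c1 := ih (k + 1) (by omega) (by omega)
    have c2 := ih (k + 2) (by omega) (by omega)
    unfold lpE2 at a b
    rw [c0, c1, c2] at a
    linear_combination b - a

theorem lp_F {V : Type*} [AddCommGroup V] [Module K V] (A B : V →ₗ[K] V) {d : ℕ}
    {θ θs φ φp : ℕ → K} {e f : ℕ → V} (he : lpSpl A B d θ θs φ e)
    (hf0 : f 0 = e 0) (hf : lpSpl A B d (fun i => θ (d - i)) θs φp f)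
    (hd : 1 ≤ d → θ 0 ≠ θ d) (hφ0 : φ 0 = 0) (hφp0 : φp 0 = 0)
    (hli : ∀ i j, i ≤ d → j ≤ d → i ≠ j → ∀ a b : K, a • e i + b • e j = 0 → a = 0 ∧ b = 0)
    (hfne : ∀ i, i ≤ d → f i ≠ 0)
    (hR : 3 ≤ d → ∃ β γ ρ, lpAW β γ ρ d θ ∧ lpR A B β γ ρ = 0) :
    (∀ j, j ≤ d → φ j = φp 1 * lpS d θ j + (θs j - θs 0) * (θ (j - 1) - θ d)) ∧
    (∀ j, j ≤ d → φp j = φ 1 * lpS d θ j + (θs j - θs 0) * (θ (d - (j - 1)) - θ 0)) ∧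
    (3 ≤ d → ∃ β γ ρ, lpAW β γ ρ d θ ∧
      ∀ i, i + 3 ≤ d → θs i - (β + 1) * θs (i + 1) + (β + 1) * θs (i + 2) - θs (i + 3) = 0) := by
  obtain ⟨heA, heB0, heB⟩ := he
  obtain ⟨hfA, hfB0, hfB⟩ := hf
  -- base cases
  have hS1 : 1 ≤ d → lpS d θ 1 = 1 := by
    intro h
    unfold lpS
    simp [div_self (sub_ne_zero.2 (hd (by omega)))]
  have hf1 : 1 ≤ d → f 1 = e 1 + (θ 0 - θ d) • e 0 := by
    intro h
    have h1 := hfA 0 (by omega)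
    rw [hf0, heA 0 (by omega)] at h1
    simp only [Nat.sub_zero, Nat.zero_add] at h1
    linear_combination (norm := module) -h1
  have b1 : 1 ≤ d → φp 1 = φ 1 + (θs 1 - θs 0) * (θ d - θ 0) := by
    intro h
    have h1 := hfB 0 (by omega)
    have h2 := heB 0 (by omega)
    simp only [Nat.zero_add] at h1 h2
    rw [hf1 h, map_add, map_smul, h2, heB0, hf0] at h1
    have h3 : (φ 1 + (θs 1 - θs 0) * (θ d - θ 0) - φp 1) • e 0 + (0 : K) • e 1 = 0 := by
      linear_combination (norm := module) h1
    have := (hli 0 1 (by omega) h (by omega) _ _ h3).1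
    linear_combination -this
  have b2 : 2 ≤ d → φp 2 = φ 1 * lpS d θ 2 + (θs 2 - θs 0) * (θ (d - 1) - θ 0) ∧
      φ 2 = φp 1 * lpS d θ 2 + (θs 2 - θs 0) * (θ 1 - θ d) := by
    intro h
    have hne := sub_ne_zero.2 (hd (by omega))
    have hS2 : (θ 0 - θ d) * lpS d θ 2 = θ 0 - θ d + θ 1 - θ (d - 1) := by
      unfold lpS
      simp only [Finset.sum_range_succ, Finset.sum_range_zero]
      field_simp
      simp
      ring
    have hf2 : f 2 = e 2 + (θ 0 + θ 1 - θ d - θ (d - 1)) • e 1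
        + ((θ 0 - θ d) * (θ 0 - θ (d - 1))) • e 0 := by
      have h1 := hfA 1 h
      rw [hf1 (by omega), map_add, map_smul, heA 0 (by omega), heA 1 h] at h1
      simp only [Nat.zero_add, Nat.reduceAdd] at h1
      linear_combination (norm := module) -h1
    have h1 := hfB 1 (by omega)
    have hb1 := heB 0 (by omega)
    have hb2 := heB 1 (by omega)
    simp only [Nat.zero_add, Nat.reduceAdd] at hb1 hb2 h1
    rw [hf2, hf1 (by omega), map_add, map_add, map_smul, map_smul, heB0, hb1, hb2] at h1
    have h3 : (φ 2 - φp 2 - (θs 2 - θs 1) * (θ 0 + θ 1 - θ d - θ (d - 1))) • e 1 +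
      (φ 1 * (θ 0 + θ 1 - θ d - θ (d - 1)) + (θs 0 - θs 2) * ((θ 0 - θ d) * (θ 0 - θ (d - 1)))
        - φp 2 * (θ 0 - θ d)) • e 0 = 0 := by
      linear_combination (norm := module) h1
    obtain ⟨q1, q2⟩ := hli 1 0 (by omega) (by omega) (by omega) _ _ h3
    have r1 : φp 2 = φ 1 * lpS d θ 2 + (θs 2 - θs 0) * (θ (d - 1) - θ 0) := by
      apply mul_left_cancel₀ hne
      linear_combination -q2 - φ 1 * hS2
    refine ⟨r1, ?_⟩
    have := b1 (by omega)
    linear_combination q1 + r1 - lpS d θ 2 * this + (θs 1 - θs 0) * hS2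
  -- TD relation
  have key : 3 ≤ d → ∃ β γ ρ, lpAW β γ ρ d θ ∧
      (∀ i, i + 3 ≤ d → θs i - (β + 1) * θs (i + 1) + (β + 1) * θs (i + 2) - θs (i + 3) = 0) ∧
      (∀ i, i + 3 ≤ d → lpE2 β γ (θ i) (θ (i + 1)) (θ (i + 2)) (θs i) (θs (i + 1)) (θs (i + 2))
          (φ i) (φ (i + 1)) (φ (i + 2)) (φ (i + 3)) = 0) ∧
      (∀ i, i + 3 ≤ d → lpE2 β γ (θ (d - i)) (θ (d - (i + 1))) (θ (d - (i + 2)))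
          (θs i) (θs (i + 1)) (θs (i + 2))
          (φp i) (φp (i + 1)) (φp (i + 2)) (φp (i + 3)) = 0) := by
    intro h
    obtain ⟨β, γ, ρ, hθ, hR⟩ := hR h
    have hb : ∀ i, i + 3 ≤ d →
        θs i - (β + 1) * θs (i + 1) + (β + 1) * θs (i + 2) - θs (i + 3) = 0 ∧
        lpE2 β γ (θ i) (θ (i + 1)) (θ (i + 2)) (θs i) (θs (i + 1)) (θs (i + 2))
          (φ i) (φ (i + 1)) (φ (i + 2)) (φ (i + 3)) = 0 := by
      intro i hi
      have h1 := lp_coreSpl A B hφ0 heA hθ i hi heB0 (fun l hl => heB l (by omega))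
      rw [hR, heB (i + 2) (by omega), LinearMap.zero_apply] at h1
      apply hli (i + 3) (i + 2) (by omega) (by omega) (by omega)
      unfold lpE2 at h1 ⊢
      linear_combination (norm := module) -h1
    refine ⟨β, γ, ρ, hθ, fun i hi => (hb i hi).1, fun i hi => (hb i hi).2, fun i hi => ?_⟩
    have h1 := lp_coreSpl (θ := fun i => θ (d - i)) A B hφp0 hfA (lpAW_rev hθ) i hi hfB0
      (fun l hl => hfB l (by omega))
    rw [hR, hfB (i + 2) (by omega), LinearMap.zero_apply] at h1
    have h2 := (hb i hi).1
    refine (smul_eq_zero.1 ?_).resolve_right (hfne (i + 2) (by omega))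
    unfold lpE2 at h1 ⊢
    linear_combination (norm := module) -h1 - h2 • f (i + 3)
  have hS0 : lpS d θ 0 = 0 := by simp [lpS]
  by_cases h3 : 3 ≤ d
  · obtain ⟨β, γ, ρ, hθ, hs, hE, hEp⟩ := key h3
    refine ⟨?_, ?_, fun _ => ⟨β, γ, ρ, hθ, hs⟩⟩
    · refine lpE2_unique (β := β) (γ := γ) (θ := θ) (θs := θs)
        (φ' := fun j => φp 1 * lpS d θ j + (θs j - θs 0) * (θ (j - 1) - θ d)) hE ?_ ?_ ?_ ?_
      · intro i hi
        exact lpE2_formula hθ i hi (hs i hi)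
          (φ := fun j => φp 1 * lpS d θ j + (θs j - θs 0) * (θ (j - 1) - θ d)) (fun j _ => rfl)
      · simp [hφ0, hS0]
      · simp only [hS1 (by omega)]
        have := b1 (by omega)
        linear_combination -this
      · exact (b2 (by omega)).2
    · refine lpE2_unique (β := β) (γ := γ) (θ := fun i => θ (d - i)) (θs := θs)
        (φ' := fun j => φ 1 * lpS d θ j + (θs j - θs 0) * (θ (d - (j - 1)) - θ 0)) hEp ?_ ?_ ?_ ?_
      · intro i hi
        exact lpE2_formula (lpAW_rev hθ) i hi (hs i hi) (C := φ 1) (D := θ 0)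
          (φ := fun j => φ 1 * lpS d θ j + (θs j - θs 0) * (θ (d - (j - 1)) - θ 0))
          (fun j hj => by rw [lpS_rev j (by omega)])
      · simp [hφp0, hS0]
      · simp only [hS1 (by omega)]
        have := b1 (by omega)
        simpa using this
      · exact (b2 (by omega)).1
  · refine ⟨?_, ?_, fun h => absurd h h3⟩
    · intro j hj
      have : j = 0 ∨ j = 1 ∨ j = 2 := by omega
      rcases this with rfl | rfl | rfl
      · simp [hφ0, hS0]
      · simp only [hS1 (by omega)]
        have := b1 (by omega)
        linear_combination -this
      · exact (b2 (by omega)).2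
    · intro j hj
      have : j = 0 ∨ j = 1 ∨ j = 2 := by omega
      rcases this with rfl | rfl | rfl
      · simp [hφp0, hS0]
      · simp only [hS1 (by omega)]
        have := b1 (by omega)
        simpa using this
      · exact (b2 (by omega)).1

theorem lp_lin_AW {d : ℕ} {θ : ℕ → K} {β : K}
    (h : ∀ i, i + 3 ≤ d → θ i - (β + 1) * θ (i + 1) + (β + 1) * θ (i + 2) - θ (i + 3) = 0) :
    ∃ γ ρ, lpAW β γ ρ d θ := by
  have h1 : ∀ i, i + 2 ≤ d → θ i - β * θ (i + 1) + θ (i + 2) = θ 0 - β * θ 1 + θ 2 := by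
    intro i
    induction i with
    | zero => intro _; rfl
    | succ i ih =>
      intro hi
      have a := ih (by omega)
      have b := h i (by omega)
      rw [show i + 1 + 1 = i + 2 by omega, show i + 1 + 2 = i + 3 by omega]
      linear_combination a - b
  refine ⟨θ 0 - β * θ 1 + θ 2, lpP β (θ 0 - β * θ 1 + θ 2) 0 (θ 0) (θ 1), ?_, h1⟩
  intro i
  induction i with
  | zero => intro _; simp only [lpP]; ring
  | succ i ih =>
    intro hi
    have a := ih (by omega)
    have b := h1 i (by omega)
    rw [show i + 1 + 1 = i + 2 by omega]
    unfold lpP at *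
    linear_combination a + (θ (i + 2) - θ i) * b

theorem lp_AW_lin {d : ℕ} {θ : ℕ → K} {β γ ρ : K} (h : lpAW β γ ρ d θ) :
    ∀ i, i + 3 ≤ d → θ i - (β + 1) * θ (i + 1) + (β + 1) * θ (i + 2) - θ (i + 3) = 0 := by
  intro i hi
  have a := h.2 i (by omega)
  have b := h.2 (i + 1) (by omega)
  rw [show i + 1 + 1 = i + 2 by omega, show i + 1 + 2 = i + 3 by omega] at b
  linear_combination a - b

theorem lp_div_iff {d : ℕ} {θ : ℕ → K} {b : K}
    (hne : ∀ i j, i ≤ d → j ≤ d → i ≠ j → θ i ≠ θ j) :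
    (∀ i, 2 ≤ i → i + 1 ≤ d → (θ (i - 2) - θ (i + 1)) / (θ (i - 1) - θ i) = b) ↔
    (∀ i, i + 3 ≤ d → θ i - b * θ (i + 1) + b * θ (i + 2) - θ (i + 3) = 0) := by
  constructor
  · intro h i hi
    have a := h (i + 2) (by omega) (by omega)
    rw [show i + 2 - 2 = i by omega, show i + 2 - 1 = i + 1 by omega,
      show i + 2 + 1 = i + 3 by omega,
      div_eq_iff (sub_ne_zero.2 (hne _ _ (by omega) (by omega) (by omega)))] at a
    linear_combination a
  · intro h i h2 hi
    obtain ⟨k, rfl⟩ := Nat.exists_eq_add_of_le' h2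
    have a := h k (by omega)
    rw [show k + 2 - 2 = k by omega, show k + 2 - 1 = k + 1 by omega,
      show k + 2 + 1 = k + 3 by omega,
      div_eq_iff (sub_ne_zero.2 (hne _ _ (by omega) (by omega) (by omega)))]
    linear_combination a

def lpIrr {d : ℕ} (M : Matrix (Fin (d + 1)) (Fin (d + 1)) K) : Prop :=
  ∀ i j : Fin (d + 1),
      (1 < |((i : ℕ) : ℤ) - ((j : ℕ) : ℤ)| → M i j = 0) ∧
      (|((i : ℕ) : ℤ) - ((j : ℕ) : ℤ)| = 1 → M i j ≠ 0)

theorem lp_aeval {n : Type*} [Fintype n] [DecidableEq n] (A P : Matrix n n K) (θ : n → K)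
    (h : A * P = P * diagonal θ) (p : K[X]) :
    Polynomial.aeval A p * P = P * diagonal (fun j => p.eval (θ j)) := by
  induction p using Polynomial.induction_on' with
  | add p q hp hq =>
    rw [map_add, add_mul, hp, hq, ← mul_add, diagonal_add]
    simp
  | monomial k a =>
    rw [aeval_monomial]
    have : A ^ k * P = P * diagonal (fun j => θ j ^ k) := by
      induction k with
      | zero => simp
      | succ k ih =>
        rw [pow_succ', mul_assoc, ih, ← mul_assoc, h, mul_assoc, diagonal_mul_diagonal]
        simp [pow_succ']
    rw [mul_assoc, this, ← mul_assoc, Algebra.commutes, mul_assoc]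
    congr 1
    rw [Matrix.algebraMap_eq_diagonal, diagonal_mul_diagonal]
    simp

theorem lp_primIdem {d : ℕ} (A P : Matrix (Fin (d + 1)) (Fin (d + 1)) K) (θ : Fin (d + 1) → K)
    (hinj : Function.Injective θ)
    (h : A * P = P * diagonal θ) (i : Fin (d + 1)) :
    primIdem A θ i * P = P * diagonal (Pi.single i 1) := by
  unfold primIdem
  rw [lp_aeval A P θ h]
  congr 2
  ext j
  rw [eval_prod]
  by_cases hj : j = i
  · subst hj
    rw [Pi.single_eq_same]
    refine Finset.prod_eq_one fun k hk => ?_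
    have : θ j - θ k ≠ 0 := sub_ne_zero.2 fun e => (Finset.ne_of_mem_erase hk) (hinj e).symm
    simp [this]
  · rw [Pi.single_eq_of_ne hj]
    refine Finset.prod_eq_zero (i := j) (by simp [hj]) (by simp)

theorem lp_eigseq_iff {d : ℕ} (A B P Q : Matrix (Fin (d + 1)) (Fin (d + 1)) K)
    (θ : Fin (d + 1) → K) (hmf : MultFreeWith A θ)
    (h : A * P = P * diagonal θ) (hPQ : P * Q = 1) (hQP : Q * P = 1) :
    IsEigenvalueSeq A B θ ↔ lpIrr (Q * B * P) := by
  have key : ∀ i j, primIdem A θ i * B * primIdem A θ j = 0 ↔ (Q * B * P) i j = 0 := by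
    intro i j
    have e : ∀ i, primIdem A θ i = P * diagonal (Pi.single i 1) * Q := fun i => by
      rw [← lp_primIdem A P θ hmf.1 h i, mul_assoc, hPQ, mul_one]
    have e2 : Q * (primIdem A θ i * B * primIdem A θ j) * P =
        diagonal (Pi.single i 1) * (Q * B * P) * diagonal (Pi.single j 1) := by
      rw [e, e]
      calc _ = (Q * P) * diagonal (Pi.single i 1) * (Q * B * P) * diagonal (Pi.single j 1)
            * (Q * P) := by simp only [mul_assoc]
        _ = _ := by rw [hQP]; simp
    have e3 : primIdem A θ i * B * primIdem A θ j = 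
        P * (diagonal (Pi.single i 1) * (Q * B * P) * diagonal (Pi.single j 1)) * Q := by
      rw [← e2]
      calc _ = (P * Q) * (primIdem A θ i * B * primIdem A θ j) * (P * Q) := by rw [hPQ]; simp
        _ = _ := by simp only [mul_assoc]
    constructor
    · intro h0
      rw [h0] at e2
      have := congrFun (congrFun e2 i) j
      simpa [Matrix.mul_diagonal, Matrix.diagonal_mul] using this.symm
    · intro h0
      rw [e3]
      have : diagonal (Pi.single i 1) * (Q * B * P) * diagonal (Pi.single j 1)
        = (0 : Matrix (Fin (d + 1)) (Fin (d + 1)) K) := by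
        ext a b
        rw [Matrix.mul_diagonal, Matrix.diagonal_mul]
        by_cases ha : a = i
        · by_cases hb : b = j
          · subst ha hb; simp [h0]
          · simp [Pi.single_eq_of_ne hb]
        · simp [Pi.single_eq_of_ne ha]
      rw [this]; simp
  unfold IsEigenvalueSeq lpIrr
  simp only [ne_eq, key, hmf, true_and]

theorem lp_mf_exists {d : ℕ} (A : Matrix (Fin (d + 1)) (Fin (d + 1)) K)
    (θ : Fin (d + 1) → K) (hmf : MultFreeWith A θ) :
    ∃ P Q : Matrix (Fin (d + 1)) (Fin (d + 1)) K, A * P = P * diagonal θ ∧ P * Q = 1 ∧ Q * P = 1 := by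
  have hev : ∀ i, ∃ v : Fin (d + 1) → K, v ≠ 0 ∧ A *ᵥ v = θ i • v := by
    intro i
    have hroot : A.charpoly.eval (θ i) = 0 := by
      rw [hmf.2, eval_prod]
      exact Finset.prod_eq_zero (Finset.mem_univ i) (by simp)
    rw [Matrix.eval_charpoly] at hroot
    obtain ⟨v, hv, hv'⟩ := Matrix.exists_mulVec_eq_zero_iff.2 hroot
    refine ⟨v, hv, ?_⟩
    rw [Matrix.sub_mulVec] at hv'
    rw [← sub_eq_zero.1 hv']
    simp [Matrix.scalar_apply, Matrix.mulVec_diagonal]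
  choose v hv hv' using hev
  have hli : LinearIndependent K v := by
    refine Module.End.eigenvectors_linearIndependent' (Matrix.toLin' A) θ hmf.1 v fun i => ?_
    refine ⟨Module.End.mem_eigenspace_iff.2 ?_, hv i⟩
    simpa using hv' i
  have hunit : IsUnit (Matrix.of v)ᵀ := by
    rw [Matrix.isUnit_transpose]
    exact (Matrix.linearIndependent_rows_iff_isUnit (A := Matrix.of v)).1 hli
  obtain ⟨u, hu⟩ := hunit
  refine ⟨(Matrix.of v)ᵀ, (u⁻¹ : _), ?_, ?_, ?_⟩
  · ext i j
    rw [Matrix.mul_diagonal]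
    have := congrFun (hv' j) i
    simp only [Matrix.mulVec, dotProduct, Pi.smul_apply, smul_eq_mul] at this
    simp only [Matrix.mul_apply, Matrix.transpose_apply, Matrix.of_apply]
    rw [this, mul_comm]
  · rw [← hu]; simp
  · rw [← hu]; simp

theorem lp_charpoly_LB {d : ℕ} (A : Matrix (Fin (d + 1)) (Fin (d + 1)) K) (h : LowerBidiagonal A) :
    A.charpoly = ∏ i, (Polynomial.X - Polynomial.C (A i i)) := by
  rw [← Matrix.charpoly_transpose]
  refine Matrix.charpoly_of_isUpperTriangular _ ?_
  intro i j hij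
  simp only [id] at hij
  exact h _ _ (by omega) (by omega)

theorem lp_charpoly_UB {d : ℕ} (A : Matrix (Fin (d + 1)) (Fin (d + 1)) K) (h : UpperBidiagonal A) :
    A.charpoly = ∏ i, (Polynomial.X - Polynomial.C (A i i)) := by
  refine Matrix.charpoly_of_isUpperTriangular _ ?_
  intro i j hij
  simp only [id] at hij
  exact h _ _ (by omega) (by omega)

theorem lp_tri {d : ℕ} (A P Q : Matrix (Fin (d + 1)) (Fin (d + 1)) K) (hA : LowerBidiagonal A)
    (hinj : Function.Injective (fun i => A i i))
    (h : A * P = P * diagonal (fun i => A i i)) (hPQ : P * Q = 1) (hQP : Q * P = 1) :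
    (∀ i j, i < j → P i j = 0) ∧ (∀ i j, i < j → Q i j = 0) ∧ (∀ i, P i i ≠ 0) ∧
      (∀ i, Q i i ≠ 0) := by
  have hQ : Q * A = diagonal (fun i => A i i) * Q := by
    calc Q * A = Q * (A * P) * Q := by rw [mul_assoc, mul_assoc, hPQ, mul_one]
      _ = (Q * P) * diagonal (fun i => A i i) * Q := by rw [h]; simp only [mul_assoc]
      _ = _ := by rw [hQP, one_mul]
  have hup : ∀ i j, i < j → A i j = 0 := fun i j hij => hA i j (by omega) (by omega)
  have h1 : ∀ i j, i < j → P i j = 0 := by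
    intro i
    induction i using WellFoundedLT.induction with
    | _ i ih =>
    intro j hij
    have e := congrFun (congrFun h i) j
    rw [Matrix.mul_diagonal, Matrix.mul_apply, Finset.sum_eq_single i] at e
    · have hne : A i i - A j j ≠ 0 := sub_ne_zero.2 fun q => hij.ne (hinj q)
      have : (A i i - A j j) * P i j = 0 := by linear_combination e
      exact (mul_eq_zero.1 this).resolve_left hne
    · intro k _ hk
      rcases lt_or_gt_of_ne hk with hk | hk
      · rw [ih k hk j (hk.trans hij), mul_zero]
      · rw [hup i k hk, zero_mul]
    · simp
  have h2 : ∀ j i, i < j → Q i j = 0 := by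
    intro j
    induction j using WellFoundedGT.induction with
    | _ j ih =>
    intro i hij
    have e := congrFun (congrFun hQ i) j
    rw [Matrix.diagonal_mul, Matrix.mul_apply, Finset.sum_eq_single j] at e
    · have hne : A j j - A i i ≠ 0 := sub_ne_zero.2 fun q => hij.ne' (hinj q)
      have : (A j j - A i i) * Q i j = 0 := by linear_combination e
      exact (mul_eq_zero.1 this).resolve_left hne
    · intro k _ hk
      rcases lt_or_gt_of_ne hk with hk | hk
      · rw [hup k j hk, mul_zero]
      · rw [ih k hk i (hij.trans hk), zero_mul]
    · simp
  have h3 : ∀ i, P i i * Q i i = 1 := by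
    intro i
    have e := congrFun (congrFun hPQ i) i
    rw [Matrix.mul_apply, Finset.sum_eq_single i] at e
    · simpa using e
    · intro k _ hk
      rcases lt_or_gt_of_ne hk with hk | hk
      · rw [h2 i k hk, mul_zero]
      · rw [h1 i k hk, zero_mul]
    · simp
  exact ⟨h1, fun i j => h2 j i, fun i h0 => by simpa [h0] using h3 i,
    fun i h0 => by simpa [h0] using h3 i⟩

theorem lp_hess {d : ℕ} (B P Q : Matrix (Fin (d + 1)) (Fin (d + 1)) K) (hB : UpperBidiagonal B)
    (h1 : ∀ i j, i < j → P i j = 0) (h2 : ∀ i j, i < j → Q i j = 0) :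
    (∀ i j : Fin (d + 1), (i : ℕ) + 1 < j → (Q * B * P) i j = 0) ∧
    (∀ i j : Fin (d + 1), (i : ℕ) + 1 = j → (Q * B * P) i j = Q i i * B i j * P j j) := by
  constructor
  · intro i j hij
    rw [Matrix.mul_apply]
    refine Finset.sum_eq_zero fun l _ => ?_
    by_cases hl : l < j
    · rw [h1 l j hl, mul_zero]
    rw [Matrix.mul_apply, Finset.sum_eq_zero, zero_mul]
    intro k _
    by_cases hk : i < k
    · rw [h2 i k hk, zero_mul]
    · rw [hB k l (by omega) (by omega), mul_zero]
  · intro i j hij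
    rw [Matrix.mul_apply, Finset.sum_eq_single j]
    · rw [Matrix.mul_apply, Finset.sum_eq_single i]
      · intro k _ hk
        by_cases hk' : i < k
        · rw [h2 i k hk', zero_mul]
        · rw [hB k j (by omega) (by omega), mul_zero]
      · simp
    · intro l _ hl
      by_cases hl' : l < j
      · rw [h1 l j hl', mul_zero]
      rw [Matrix.mul_apply, Finset.sum_eq_zero, zero_mul]
      intro k _
      by_cases hk : i < k
      · rw [h2 i k hk, zero_mul]
      · rw [hB k l (by omega) (by omega), mul_zero]
    · simp

theorem lpIrr_of_hess {d : ℕ} (M : Matrix (Fin (d + 1)) (Fin (d + 1)) K)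
    (h1 : ∀ i j : Fin (d + 1), (i : ℕ) + 1 < j → M i j = 0)
    (h2 : ∀ i j : Fin (d + 1), (i : ℕ) + 1 = j → M i j ≠ 0)
    (hs : ∀ i j, i ≠ j → (M i j = 0 ↔ M j i = 0)) : lpIrr M := by
  intro i j
  constructor
  · intro h
    rw [lt_abs] at h
    rcases h with h | h
    · exact (hs j i (by omega)).1 (h1 j i (by omega))
    · exact h1 i j (by omega)
  · intro h h0
    rw [abs_eq (by norm_num)] at h
    rcases h with h | h
    · exact h2 j i (by omega) ((hs i j (by omega)).1 h0)
    · exact h2 i j (by omega) h0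

theorem lpIrr_symm {d : ℕ} {M : Matrix (Fin (d + 1)) (Fin (d + 1)) K} (h : lpIrr M)
    (i j : Fin (d + 1)) (hij : i ≠ j) : M i j = 0 ↔ M j i = 0 := by
  by_cases h1 : |((i : ℕ) : ℤ) - ((j : ℕ) : ℤ)| = 1
  · have a := (h i j).2 h1
    have b := (h j i).2 (by rw [abs_sub_comm]; exact h1)
    simp [a, b]
  · have h2 : 1 < |((i : ℕ) : ℤ) - ((j : ℕ) : ℤ)| := by
      have : 0 < |((i : ℕ) : ℤ) - ((j : ℕ) : ℤ)| := abs_pos.2 (by omega)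
      omega
    have a := (h i j).1 h2
    have b := (h j i).1 (by rw [abs_sub_comm]; exact h2)
    simp [a, b]

theorem lpIrr_transpose {d : ℕ} {M : Matrix (Fin (d + 1)) (Fin (d + 1)) K} (h : lpIrr M) :
    lpIrr Mᵀ := by
  intro i j
  rw [abs_sub_comm]
  exact h j i

theorem lp_eigseq_transpose {d : ℕ} (A B : Matrix (Fin (d + 1)) (Fin (d + 1)) K)
    (θ : Fin (d + 1) → K) (h : IsEigenvalueSeq A B θ) : IsEigenvalueSeq Aᵀ Bᵀ θ := by
  obtain ⟨P, Q, hP, hPQ, hQP⟩ := lp_mf_exists A θ h.1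
  have hI := (lp_eigseq_iff A B P Q θ h.1 hP hPQ hQP).1 h
  have hmf : MultFreeWith Aᵀ θ := ⟨h.1.1, by rw [Matrix.charpoly_transpose]; exact h.1.2⟩
  have hQ : Q * A = diagonal θ * Q := by
    calc Q * A = Q * (A * P) * Q := by rw [mul_assoc, mul_assoc, hPQ, mul_one]
      _ = (Q * P) * diagonal θ * Q := by rw [hP]; simp only [mul_assoc]
      _ = _ := by rw [hQP, one_mul]
  refine (lp_eigseq_iff Aᵀ Bᵀ Qᵀ Pᵀ θ hmf ?_ ?_ ?_).2 ?_
  · rw [← Matrix.transpose_mul, hQ, Matrix.transpose_mul, Matrix.diagonal_transpose]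
  · rw [← Matrix.transpose_mul, hPQ, Matrix.transpose_one]
  · rw [← Matrix.transpose_mul, hQP, Matrix.transpose_one]
  · have := lpIrr_transpose hI
    rw [Matrix.transpose_mul, Matrix.transpose_mul, ← mul_assoc] at this
    exact this

/-- the ordering by diagonal entries is standard -/
theorem lp_standard {d : ℕ} (A B : Matrix (Fin (d + 1)) (Fin (d + 1)) K)
    (hA : LowerBidiagonal A) (hB : UpperBidiagonal B) (θ' : Fin (d + 1) → K)
    (h : IsEigenvalueSeq A B θ') :
    Function.Injective (fun i => A i i) ∧ (∀ i j : Fin (d + 1), (i : ℕ) + 1 = j → B i j ≠ 0) ∧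
    ∃ P Q : Matrix (Fin (d + 1)) (Fin (d + 1)) K,
      A * P = P * diagonal (fun i => A i i) ∧ P * Q = 1 ∧ Q * P = 1 ∧ lpIrr (Q * B * P) := by
  have hcp := lp_charpoly_LB A hA
  have hcp' := h.1.2
  have hroots : Finset.univ.val.map (fun i => A i i) = Finset.univ.val.map θ' := by
    have a := congrArg Polynomial.roots (hcp.symm.trans hcp')
    have b : ∀ f : Fin (d + 1) → K,
        (∏ i, (Polynomial.X - Polynomial.C (f i))).roots = Finset.univ.val.map f := by
      intro f
      conv_rhs => rw [← Polynomial.roots_multiset_prod_X_sub_C (Finset.univ.val.map f)]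
      rw [Multiset.map_map]
      rfl
    rw [b, b] at a
    exact a
  have hinj : Function.Injective (fun i => A i i) := by
    have : (Finset.univ.val.map (fun i => A i i)).Nodup := by
      rw [hroots]; exact Finset.univ.nodup.map h.1.1
    intro i j hij
    exact Multiset.inj_on_of_nodup_map this i (by simp) j (by simp) hij
  have hτ : ∀ i, ∃ j, θ' j = A i i := by
    intro i
    have : A i i ∈ Finset.univ.val.map θ' := by
      rw [← hroots]; exact Multiset.mem_map.2 ⟨i, by simp, rfl⟩
    obtain ⟨j, -, hj⟩ := Multiset.mem_map.1 this
    exact ⟨j, hj⟩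
  choose τ hτ using hτ
  have hτinj : Function.Injective τ := by
    intro i j hij
    apply hinj
    change A i i = A j j
    rw [← hτ i, ← hτ j, hij]
  have hτbij : Function.Bijective τ := Finite.injective_iff_bijective.1 hτinj
  let σ : Fin (d + 1) ≃ Fin (d + 1) := Equiv.ofBijective τ hτbij
  obtain ⟨P', Q', hP', hPQ', hQP'⟩ := lp_mf_exists A θ' h.1
  have hI' := (lp_eigseq_iff A B P' Q' θ' h.1 hP' hPQ' hQP').1 h
  let P := P'.submatrix id τ
  let Q := Q'.submatrix τ id
  have hQP : Q * P = 1 := by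
    change Q'.submatrix τ id * P'.submatrix id τ = 1
    rw [← Matrix.submatrix_mul _ _ _ _ _ Function.bijective_id, hQP']
    exact Matrix.submatrix_one _ hτinj
  have hPQ : P * Q = 1 := mul_eq_one_comm.1 hQP
  have hP : A * P = P * diagonal (fun i => A i i) := by
    ext i j
    have := congrFun (congrFun hP' i) (τ j)
    rw [Matrix.mul_diagonal, hτ] at this
    rw [Matrix.mul_diagonal]
    exact this
  have hM : Q * B * P = (Q' * B * P').submatrix τ τ := by
    ext i j
    simp [Matrix.mul_apply, P, Q]
  have hsym : ∀ i j, i ≠ j → ((Q * B * P) i j = 0 ↔ (Q * B * P) j i = 0) := by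
    intro i j hij
    rw [hM]
    exact lpIrr_symm hI' _ _ (fun e => hij (hτinj e))
  obtain ⟨t1, t2, t3, t4⟩ := lp_tri A P Q hA hinj hP hPQ hQP
  obtain ⟨k1, k2⟩ := lp_hess B P Q hB t1 t2
  have hne : ∀ i j : Fin (d + 1), (i : ℕ) + 1 = j → B i j ≠ 0 := by
    intro i j hij h0
    have hz : ∀ p q : Fin (d + 1), p ≤ i → i < q → (Q * B * P) p q = 0 := by
      intro p q hp hq
      by_cases hpq : (p : ℕ) + 1 < q
      · exact k1 p q hpq
      · have e1 : p = i := by omega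
        have e2 : q = j := by omega
        subst e1 e2
        rw [k2 _ _ hij, h0]; simp
    have hconst : ∀ n : ℕ, ∀ hn : n < d + 1, (σ.symm ⟨n, hn⟩ ≤ i ↔ σ.symm ⟨0, by omega⟩ ≤ i) := by
      intro n
      induction n with
      | zero => intro _; rfl
      | succ n ih =>
        intro hn
        rw [← ih (by omega)]
        set x := σ.symm ⟨n, by omega⟩ with hx
        set y := σ.symm ⟨n + 1, hn⟩ with hy
        have hx' : τ x = ⟨n, by omega⟩ := σ.apply_symm_apply _
        have hy' : τ y = ⟨n + 1, hn⟩ := σ.apply_symm_apply _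
        have hxy : (Q * B * P) x y ≠ 0 := by
          rw [hM, Matrix.submatrix_apply, hx', hy']
          apply (hI' _ _).2
          simp
        have hyx : (Q * B * P) y x ≠ 0 := by
          rw [hM, Matrix.submatrix_apply, hx', hy']
          apply (hI' _ _).2
          simp
        constructor
        · intro hyi
          by_contra hxi
          exact hyx (hz y x hyi (not_le.1 hxi))
        · intro hxi
          by_contra hyi
          exact hxy (hz x y hxi (not_le.1 hyi))
    have c1 := hconst (τ i) (τ i).2
    have c2 := hconst (τ j) (τ j).2
    rw [show σ.symm ⟨(τ i : ℕ), (τ i).2⟩ = i from σ.symm_apply_apply i] at c1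
    rw [show σ.symm ⟨(τ j : ℕ), (τ j).2⟩ = j from σ.symm_apply_apply j] at c2
    have := c2.2 (c1.1 le_rfl)
    omega
  refine ⟨hinj, hne, P, Q, hP, hPQ, hQP, ?_⟩
  refine lpIrr_of_hess _ k1 ?_ hsym
  intro i j hij
  rw [k2 i j hij]
  exact mul_ne_zero (mul_ne_zero (t4 i) (hne i j hij)) (t3 j)

/-- symmetrisation -/
theorem lp_symm {d : ℕ} (M W W' : Matrix (Fin (d + 1)) (Fin (d + 1)) K) (θ θs : Fin (d + 1) → K)
    (hinj : Function.Injective θs) (hM : lpIrr M) (hW : M * W = W * diagonal θs)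
    (h1 : W * W' = 1) (i j : Fin (d + 1)) :
    (W' * diagonal θ * W) i j = 0 ↔ (W' * diagonal θ * W) j i = 0 := by
  let c : ℕ → K := fun k => if h : k + 1 < d + 1 then
    M ⟨k, by omega⟩ ⟨k + 1, h⟩ / M ⟨k + 1, h⟩ ⟨k, by omega⟩ else 1
  have hc : ∀ k, c k ≠ 0 := by
    intro k
    by_cases h : k + 1 < d + 1
    · simp only [c, h, dite_true]
      refine div_ne_zero ((hM _ _).2 ?_) ((hM _ _).2 ?_) <;> simp
    · simp only [c, h, dite_false]; simp
  let δ : Fin (d + 1) → K := fun i => ∏ k ∈ Finset.range (i : ℕ), c k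
  have hδ : ∀ i, δ i ≠ 0 := fun i => Finset.prod_ne_zero_iff.2 fun k _ => hc k
  have hstep : ∀ i j : Fin (d + 1), (i : ℕ) + 1 = j → δ i * M i j = M j i * δ j := by
    intro i j hij
    have e : δ j = δ i * c i := by
      simp only [δ]; rw [← hij, Finset.prod_range_succ]
    have hlt : (i : ℕ) + 1 < d + 1 := by omega
    have hj : j = ⟨(i : ℕ) + 1, hlt⟩ := by ext; simp [hij]
    have hne : M j i ≠ 0 := (hM _ _).2 (by rw [← hij]; simp)
    have : c i = M i j / M j i := by
      simp only [c, hlt, dite_true, hj]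
    rw [e, this]
    field_simp
  have hΔ : diagonal δ * M = Mᵀ * diagonal δ := by
    ext i j
    rw [Matrix.diagonal_mul, Matrix.mul_diagonal, Matrix.transpose_apply]
    by_cases e : i = j
    · subst e; ring
    by_cases e1 : (i : ℕ) + 1 = j
    · exact hstep i j e1
    by_cases e2 : (j : ℕ) + 1 = i
    · linear_combination -hstep j i e2
    have q : 1 < |((i : ℕ) : ℤ) - ((j : ℕ) : ℤ)| := by
      rw [lt_abs]; omega
    rw [(hM i j).1 q, (hM j i).1 (by rw [abs_sub_comm]; exact q)]; ring
  let E := Wᵀ * diagonal δ * W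
  have hED : E * diagonal θs = diagonal θs * E := by
    have hWt : Wᵀ * Mᵀ = diagonal θs * Wᵀ := by
      rw [← Matrix.transpose_mul, hW, Matrix.transpose_mul, Matrix.diagonal_transpose]
    calc E * diagonal θs = Wᵀ * diagonal δ * (W * diagonal θs) := by simp only [E, mul_assoc]
      _ = Wᵀ * (diagonal δ * M) * W := by rw [← hW]; simp only [mul_assoc]
      _ = (Wᵀ * Mᵀ) * diagonal δ * W := by rw [hΔ]; simp only [mul_assoc]
      _ = _ := by rw [hWt]; simp only [E, mul_assoc]
  have hEoff : ∀ i j, i ≠ j → E i j = 0 := by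
    intro i j hij
    have := congrFun (congrFun hED i) j
    rw [Matrix.mul_diagonal, Matrix.diagonal_mul] at this
    have q : (θs j - θs i) * E i j = 0 := by linear_combination this
    exact (mul_eq_zero.1 q).resolve_left (sub_ne_zero.2 fun e => hij (hinj e).symm)
  have hEdiag : E = diagonal (fun i => E i i) := by
    ext i j
    by_cases e : i = j
    · subst e; simp
    · rw [hEoff i j e, Matrix.diagonal_apply_ne _ e]
  have hEne : ∀ i, E i i ≠ 0 := by
    have hdet : E.det ≠ 0 := by
      simp only [E, Matrix.det_mul, Matrix.det_transpose, Matrix.det_diagonal]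
      have hw : W.det ≠ 0 := by
        intro h0
        have := congrArg Matrix.det h1
        rw [Matrix.det_mul, h0] at this
        simp at this
      exact mul_ne_zero (mul_ne_zero hw (Finset.prod_ne_zero_iff.2 fun i _ => hδ i)) hw
    rw [hEdiag, Matrix.det_diagonal] at hdet
    exact fun i => Finset.prod_ne_zero_iff.1 hdet i (Finset.mem_univ i)
  have hEC : E * (W' * diagonal θ * W) = Wᵀ * (diagonal δ * diagonal θ) * W := by
    calc _ = Wᵀ * diagonal δ * (W * W') * diagonal θ * W := by simp only [E, mul_assoc]
      _ = _ := by rw [h1, mul_one]; simp only [mul_assoc]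
  have hsy : (E * (W' * diagonal θ * W))ᵀ = E * (W' * diagonal θ * W) := by
    rw [hEC, diagonal_mul_diagonal]
    simp only [Matrix.transpose_mul, Matrix.transpose_transpose, Matrix.diagonal_transpose, mul_assoc]
  have := congrFun (congrFun hsy i) j
  rw [Matrix.transpose_apply, hEdiag, Matrix.diagonal_mul, Matrix.diagonal_mul] at this
  constructor
  · intro h; rw [h, mul_zero] at this; exact (mul_eq_zero.1 this).resolve_left (hEne j)
  · intro h; rw [h, mul_zero] at this; exact (mul_eq_zero.1 this.symm).resolve_left (hEne i)

def lpX {d : ℕ} (A : Matrix (Fin (d + 1)) (Fin (d + 1)) K) (i j : ℕ) : K :=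
  if h : i < d + 1 ∧ j < d + 1 then A ⟨i, h.1⟩ ⟨j, h.2⟩ else 0

def lpC {d : ℕ} (A : Matrix (Fin (d + 1)) (Fin (d + 1)) K) (i : ℕ) : K :=
  ∏ h ∈ Finset.range i, lpX A (h + 1) h

def lpE {d : ℕ} (A : Matrix (Fin (d + 1)) (Fin (d + 1)) K) (i : ℕ) : Fin (d + 1) → K :=
  fun k => if (k : ℕ) = i then lpC A i else 0

theorem lpC_zero {d : ℕ} (A : Matrix (Fin (d + 1)) (Fin (d + 1)) K) : lpC A 0 = 1 := by
  simp [lpC]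

theorem lpC_succ {d : ℕ} (A : Matrix (Fin (d + 1)) (Fin (d + 1)) K) (i j : Fin (d + 1))
    (h : (j : ℕ) + 1 = i) : lpC A ((j : ℕ) + 1) = lpC A j * A i j := by
  unfold lpC
  rw [Finset.prod_range_succ]
  congr 1
  unfold lpX
  rw [dif_pos ⟨by omega, by omega⟩]
  have hi : (⟨(j : ℕ) + 1, by omega⟩ : Fin (d + 1)) = i := by ext; simp [h]
  exact congrFun (congrArg A hi) j

theorem lpC_ne {d : ℕ} (A : Matrix (Fin (d + 1)) (Fin (d + 1)) K)
    (hs : ∀ i j : Fin (d + 1), (j : ℕ) + 1 = i → A i j ≠ 0) (i : ℕ) (hi : i ≤ d) :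
    lpC A i ≠ 0 := by
  unfold lpC
  refine Finset.prod_ne_zero_iff.2 fun h hh => ?_
  rw [Finset.mem_range] at hh
  unfold lpX
  rw [dif_pos ⟨by omega, by omega⟩]
  exact hs _ _ rfl

theorem lp_mulVec_E {d : ℕ} (A M : Matrix (Fin (d + 1)) (Fin (d + 1)) K) (i k : Fin (d + 1)) :
    (M *ᵥ lpE A i) k = M k i * lpC A i := by
  simp only [Matrix.mulVec, dotProduct, lpE]
  rw [Finset.sum_eq_single i]
  · simp
  · intro b _ hb
    rw [if_neg (by omega), mul_zero]
  · simp

theorem lp_split {d : ℕ} (A B : Matrix (Fin (d + 1)) (Fin (d + 1)) K) (hA : LowerBidiagonal A)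
    (hB : UpperBidiagonal B) (θ θs φ : ℕ → K) (hθ : ∀ i : Fin (d + 1), A i i = θ i)
    (hθs : ∀ i : Fin (d + 1), B i i = θs i)
    (hφ : ∀ i j : Fin (d + 1), (j : ℕ) + 1 = i → A i j * B j i = φ i) :
    lpSpl (Matrix.toLin' A) (Matrix.toLin' B) d θ θs φ (lpE A) := by
  refine ⟨fun i hi => ?_, ?_, fun i hi => ?_⟩
  · have i0 : i < d + 1 := by omega
    have i1 : i + 1 < d + 1 := by omega
    ext k
    have h := lp_mulVec_E A A ⟨i, i0⟩ k
    rw [Matrix.toLin'_apply]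
    simp only at h
    rw [h]
    have hc := lpC_succ A ⟨i + 1, i1⟩ ⟨i, i0⟩ rfl
    simp only at hc
    simp only [Pi.add_apply, Pi.smul_apply, smul_eq_mul, lpE]
    by_cases h1 : (k : ℕ) = i
    · have : k = ⟨i, i0⟩ := by ext; exact h1
      subst this
      rw [hθ]
      simp
    · by_cases h2 : (k : ℕ) = i + 1
      · have : k = ⟨i + 1, i1⟩ := by ext; exact h2
        subst this
        rw [if_neg h1, if_pos h2, hc]; ring
      · rw [if_neg h1, if_neg h2, hA k _ h1 h2]; simp
  · ext k
    have h := lp_mulVec_E A B 0 k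
    rw [Matrix.toLin'_apply]
    simp only [Fin.val_zero] at h
    rw [h]
    simp only [Pi.smul_apply, smul_eq_mul, lpE]
    by_cases h1 : (k : ℕ) = 0
    · have : k = 0 := by ext; exact h1
      subst this
      rw [hθs]; simp
    · rw [if_neg h1, hB k 0 (by simpa using h1) (by simp)]; simp
  · have i0 : i < d + 1 := by omega
    have i1 : i + 1 < d + 1 := by omega
    ext k
    have h := lp_mulVec_E A B ⟨i + 1, i1⟩ k
    rw [Matrix.toLin'_apply]
    simp only at h
    rw [h]
    have hc := lpC_succ A ⟨i + 1, i1⟩ ⟨i, i0⟩ rfl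
    simp only at hc
    have hp := hφ ⟨i + 1, i1⟩ ⟨i, i0⟩ rfl
    simp only [Pi.add_apply, Pi.smul_apply, smul_eq_mul, lpE]
    by_cases h1 : (k : ℕ) = i + 1
    · have : k = ⟨i + 1, i1⟩ := by ext; exact h1
      subst this
      rw [hθs]
      simp
    · by_cases h2 : (k : ℕ) = i
      · have : k = ⟨i, i0⟩ := by ext; exact h2
        subst this
        rw [if_neg h1, if_pos h2, hc, ← hp]; ring
      · rw [if_neg h1, if_neg h2, hB k _ h1 (by simp only; omega)]; simp

theorem lp_E_zero {d : ℕ} (A M : Matrix (Fin (d + 1)) (Fin (d + 1)) K) (k : Fin (d + 1)) :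
    (M *ᵥ lpE A 0) k = M k 0 := by
  have := lp_mulVec_E A M 0 k
  simpa [lpC_zero] using this

theorem lp_E_li {d : ℕ} (A : Matrix (Fin (d + 1)) (Fin (d + 1)) K)
    (hs : ∀ i j : Fin (d + 1), (j : ℕ) + 1 = i → A i j ≠ 0) (i j : ℕ) (hi : i ≤ d) (hj : j ≤ d)
    (hij : i ≠ j) (a b : K) (h : a • lpE A i + b • lpE A j = 0) : a = 0 ∧ b = 0 := by
  have h1 := congrFun h ⟨i, by omega⟩
  have h2 := congrFun h ⟨j, by omega⟩
  have ci := lpC_ne A hs i hi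
  have cj := lpC_ne A hs j hj
  simp [lpE, hij, hij.symm, ci, cj] at h1 h2
  exact ⟨h1, h2⟩

theorem lp_coord {d : ℕ} (A Q : Matrix (Fin (d + 1)) (Fin (d + 1)) K) (θ τ : ℕ → K)
    (hQ : Q * A = diagonal (fun i : Fin (d + 1) => θ i) * Q) (u : ℕ → Fin (d + 1) → K)
    (hu : ∀ i, i < d → Matrix.toLin' A (u i) = τ i • u i + u (i + 1)) (i : ℕ) (hi : i ≤ d)
    (j : Fin (d + 1)) :
    (Q *ᵥ u i) j = (∏ h ∈ Finset.range i, (θ j - τ h)) * (Q *ᵥ u 0) j := by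
  induction i with
  | zero => simp
  | succ i ih =>
    have h := hu i (by omega)
    rw [Matrix.toLin'_apply] at h
    have h2 : u (i + 1) = A *ᵥ u i - τ i • u i := by rw [h]; simp
    rw [h2, Matrix.mulVec_sub, Matrix.mulVec_mulVec, hQ, ← Matrix.mulVec_mulVec, Matrix.mulVec_smul,
      Pi.sub_apply, Matrix.mulVec_diagonal, Pi.smul_apply, ih (by omega), Finset.prod_range_succ]
    simp only [smul_eq_mul]
    ring

theorem lp_Q0 {d : ℕ} (A P Q : Matrix (Fin (d + 1)) (Fin (d + 1)) K) (θ : ℕ → K)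
    (hs : ∀ i j : Fin (d + 1), (j : ℕ) + 1 = i → A i j ≠ 0) (hQP : Q * P = 1)
    (hQ : Q * A = diagonal (fun i : Fin (d + 1) => θ i) * Q)
    (hu : ∀ i, i < d → Matrix.toLin' A (lpE A i) = θ i • lpE A i + lpE A (i + 1))
    (j : Fin (d + 1)) : Q j 0 ≠ 0 := by
  intro h0
  have hz : ∀ k, Q j k = 0 := by
    intro k
    have h := lp_coord A Q θ θ hQ (lpE A) hu k (by omega) j
    rw [lp_E_zero, h0, mul_zero, lp_mulVec_E] at h
    exact (mul_eq_zero.1 h).resolve_right (lpC_ne A hs k (by omega))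
  have := congrFun (congrFun hQP j) j
  rw [Matrix.mul_apply, Finset.sum_eq_zero (fun k _ => by rw [hz k, zero_mul])] at this
  simp at this

def lpF {V : Type*} [AddCommGroup V] [Module K V] (A : V →ₗ[K] V) (τ : ℕ → K) (e : V) : ℕ → V
  | 0 => e
  | i + 1 => A (lpF A τ e i) - τ i • lpF A τ e i

theorem lpF_raise {V : Type*} [AddCommGroup V] [Module K V] (A : V →ₗ[K] V) (τ : ℕ → K) (e : V)
    (i : ℕ) : A (lpF A τ e i) = τ i • lpF A τ e i + lpF A τ e (i + 1) := by
  simp [lpF]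

/-- support of the reversed split family in the eigenbasis -/
theorem lp_supp {d : ℕ} (A P Q : Matrix (Fin (d + 1)) (Fin (d + 1)) K) (θ : ℕ → K)
    (hs : ∀ i j : Fin (d + 1), (j : ℕ) + 1 = i → A i j ≠ 0) (hQP : Q * P = 1)
    (hQ : Q * A = diagonal (fun i : Fin (d + 1) => θ i) * Q)
    (hne : ∀ i j, i ≤ d → j ≤ d → i ≠ j → θ i ≠ θ j)
    (hu : ∀ i, i < d → Matrix.toLin' A (lpE A i) = θ i • lpE A i + lpE A (i + 1))
    (f : ℕ → Fin (d + 1) → K) (hf0 : f 0 = lpE A 0)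
    (hf : ∀ i, i < d → Matrix.toLin' A (f i) = θ (d - i) • f i + f (i + 1)) (i : ℕ) (hi : i ≤ d)
    (j : Fin (d + 1)) : (Q *ᵥ f i) j = 0 ↔ d < i + j := by
  rw [lp_coord A Q θ (fun i => θ (d - i)) hQ f hf i hi j, hf0, lp_E_zero]
  have hq := lp_Q0 A P Q θ hs hQP hQ hu j
  simp only [mul_eq_zero, hq, or_false, Finset.prod_eq_zero_iff, Finset.mem_range, sub_eq_zero]
  constructor
  · rintro ⟨h, hh, he⟩
    by_contra hc
    exact hne j (d - h) (by omega) (by omega) (by omega) he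
  · intro h
    exact ⟨d - j, by omega, by rw [show d - (d - j) = (j : ℕ) by omega]⟩

theorem lp_QA {n : Type*} [Fintype n] [DecidableEq n] (A P Q D : Matrix n n K)
    (h : A * P = P * D) (hPQ : P * Q = 1) (hQP : Q * P = 1) : Q * A = D * Q := by
  calc Q * A = Q * (A * P) * Q := by rw [mul_assoc, mul_assoc, hPQ, mul_one]
      _ = (Q * P) * D * Q := by rw [h]; simp only [mul_assoc]
      _ = _ := by rw [hQP, one_mul]

theorem lp_low {d : ℕ} (M : Matrix (Fin (d + 1)) (Fin (d + 1)) K) (θs φp : ℕ → K)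
    (g : ℕ → Fin (d + 1) → K) (hg : ∀ i, i ≤ d → ∀ j : Fin (d + 1), g i j = 0 ↔ d < i + j)
    (hφp : ∀ i, 1 ≤ i → i ≤ d → φp i ≠ 0)
    (hM : ∀ i, i < d → M *ᵥ g (i + 1) = θs (i + 1) • g (i + 1) + φp (i + 1) • g i) :
    ∀ j k : Fin (d + 1), ((j : ℕ) + 1 < k → M k j = 0) ∧ ((j : ℕ) + 1 = k → M k j ≠ 0) := by
  intro j
  induction j using WellFoundedLT.induction with
  | _ j ih =>
  have key : ∀ k : Fin (d + 1), j < k →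
      M k j * g (d - j - 1 + 1) j = φp (d - j - 1 + 1) * g (d - j - 1) k := by
    intro k hk
    have h := congrFun (hM (d - j - 1) (by omega)) k
    simp only [Pi.add_apply, Pi.smul_apply, smul_eq_mul] at h
    rw [(hg (d - j - 1 + 1) (by omega) k).2 (by omega), mul_zero, zero_add] at h
    rw [← h, Matrix.mulVec, dotProduct, Finset.sum_eq_single j]
    · intro l _ hl
      rcases lt_or_gt_of_ne hl with hl | hl
      · rw [(ih l hl k).1 (by omega), zero_mul]
      · rw [(hg (d - j - 1 + 1) (by omega) l).2 (by omega), mul_zero]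
    · simp
  intro k
  constructor
  · intro hk
    have h := key k (by omega)
    rw [(hg (d - j - 1) (by omega) k).2 (by omega), mul_zero] at h
    refine (mul_eq_zero.1 h).resolve_right fun h0 => ?_
    have := (hg _ (by omega) _).1 h0
    omega
  · intro hk h0
    have h := key k (by omega)
    rw [h0, zero_mul] at h
    rcases mul_eq_zero.1 h.symm with h1 | h1
    · exact hφp _ (by omega) (by omega) h1
    · have := (hg _ (by omega) _).1 h1
      omega

theorem lp_back {d : ℕ} (A B : Matrix (Fin (d + 1)) (Fin (d + 1)) K) (hA : LowerBidiagonal A)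
    (hB : UpperBidiagonal B) (θ θs φ φp : ℕ → K) (hpa : IsParameterArray K d θ θs φ φp)
    (hθ : ∀ i : Fin (d + 1), A i i = θ i) (hθs : ∀ i : Fin (d + 1), B i i = θs i)
    (hφ : ∀ i j : Fin (d + 1), (j : ℕ) + 1 = i → A i j * B j i = φ i) : IsLeonardPair A B := by
  obtain ⟨p1, p2, p3, p4, b, p5⟩ := hpa
  have hne : ∀ i j, i ≤ d → j ≤ d → i ≠ j → θ i ≠ θ j := fun i j hi hj h => (p2 i j hi hj h).1
  have hnes : ∀ i j, i ≤ d → j ≤ d → i ≠ j → θs i ≠ θs j := fun i j hi hj h => (p2 i j hi hj h).2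
  have hinj : Function.Injective (fun i => A i i) := by
    intro i j h
    by_contra hc
    simp only [hθ] at h
    exact hne i j (by omega) (by omega) (by omega) h
  have hinjs : Function.Injective (fun i => B i i) := by
    intro i j h
    by_contra hc
    simp only [hθs] at h
    exact hnes i j (by omega) (by omega) (by omega) h
  have hprod : ∀ i j : Fin (d + 1), (j : ℕ) + 1 = i → A i j * B j i ≠ 0 := by
    intro i j h
    rw [hφ i j h]
    exact (p1 i (by omega) (by omega)).1
  have hsA : ∀ i j : Fin (d + 1), (j : ℕ) + 1 = i → A i j ≠ 0 :=
    fun i j h => left_ne_zero_of_mul (hprod i j h)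
  have hsB : ∀ i j : Fin (d + 1), (i : ℕ) + 1 = j → B i j ≠ 0 :=
    fun i j h => right_ne_zero_of_mul (hprod j i h)
  have hmf : MultFreeWith A (fun i => A i i) := ⟨hinj, lp_charpoly_LB A hA⟩
  have hmfs : MultFreeWith B (fun i => B i i) := ⟨hinjs, lp_charpoly_UB B hB⟩
  obtain ⟨P, Q, hP, hPQ, hQP⟩ := lp_mf_exists A _ hmf
  obtain ⟨Ps, Qs, hPs, hPQs, hQPs⟩ := lp_mf_exists B _ hmfs
  have hQ := lp_QA A P Q _ hP hPQ hQP
  have hQs := lp_QA B Ps Qs _ hPs hPQs hQPs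
  obtain ⟨t1, t2, t3, t4⟩ := lp_tri A P Q hA hinj hP hPQ hQP
  obtain ⟨u1, u2⟩ := lp_hess B P Q hB t1 t2
  -- the split families
  let φ' : ℕ → K := fun j => if j = 0 then 0 else φ j
  let φp' : ℕ → K := fun j => if j = 0 then 0 else φp j
  have he : lpSpl (Matrix.toLin' A) (Matrix.toLin' B) d θ θs φ' (lpE A) := by
    refine lp_split A B hA hB θ θs φ' hθ hθs fun i j h => ?_
    rw [hφ i j h]
    simp only [φ']
    rw [if_neg (by omega)]
  let f := lpF (Matrix.toLin' A) (fun i => θ (d - i)) (lpE A 0)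
  have hf0 : f 0 = lpE A 0 := rfl
  have hf : ∀ i, i < d → Matrix.toLin' A (f i) = θ (d - i) • f i + f (i + 1) :=
    fun i _ => lpF_raise _ _ _ i
  have hfB : lpSpl (Matrix.toLin' A) (Matrix.toLin' B) d (fun i => θ (d - i)) θs φp' f := by
    refine lp_G _ _ he hf0 hf (fun h => hne 0 d (by omega) le_rfl (by omega)) ?_ ?_ ?_
    · intro j hj
      by_cases h : j = 0
      · subst h; simp [φ', lpS]
      · simp only [φ', φp', if_neg h]
        exact p3 j (by omega) hj
    · intro j hj
      by_cases h : j = 0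
      · subst h; simp [φp', lpS]
      · simp only [φ', φp', if_neg h]
        rw [show d - (j - 1) = d - j + 1 by omega]
        exact p4 j (by omega) hj
    · intro _
      have r1 := (lp_div_iff (b := b) hne).1 fun i h2 h3 => (p5 i h2 h3).1
      have r2 := (lp_div_iff (b := b) hnes).1 fun i h2 h3 => (p5 i h2 h3).2
      obtain ⟨γ, ρ, h⟩ := lp_lin_AW (β := b - 1) (d := d) (θ := θ) (by simpa using r1)
      exact ⟨b - 1, γ, ρ, h, by simpa using r2⟩
  have hQ' : Q * A = diagonal (fun i : Fin (d + 1) => θ i) * Q := by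
    rw [hQ]; simp only [hθ]
  have hlow := lp_low (Q * B * P) θs φp' (fun i => Q *ᵥ f i)
    (lp_supp A P Q θ hsA hQP hQ' hne he.1 f hf0 hf)
    (fun i h1 h2 => by
      simp only [φp']
      rw [if_neg (by omega)]
      exact (p1 i h1 h2).2)
    (fun i hi => by
      have h := hfB.2.2 i hi
      rw [Matrix.toLin'_apply] at h
      rw [Matrix.mulVec_mulVec, mul_assoc, hPQ, mul_one, ← Matrix.mulVec_mulVec, h,
        Matrix.mulVec_add, Matrix.mulVec_smul, Matrix.mulVec_smul])
  have hIrr : lpIrr (Q * B * P) := by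
    intro i j
    constructor
    · intro h
      rw [lt_abs] at h
      rcases h with h | h
      · exact (hlow j i).1 (by omega)
      · exact u1 i j (by omega)
    · intro h
      rw [abs_eq (by norm_num)] at h
      rcases h with h | h
      · exact (hlow j i).2 (by omega)
      · rw [u2 i j (by omega)]
        exact mul_ne_zero (mul_ne_zero (t4 i) (hsB i j (by omega))) (t3 j)
  refine ⟨⟨_, (lp_eigseq_iff A B P Q _ hmf hP hPQ hQP).2 hIrr⟩,
    ⟨_, (lp_eigseq_iff B A Ps Qs _ hmfs hPs hPQs hQPs).2 ?_⟩⟩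
  have hBt : LowerBidiagonal Bᵀ := fun i j h1 h2 => hB j i (Ne.symm h1) h2
  have hAt : UpperBidiagonal Aᵀ := fun i j h1 h2 => hA j i (Ne.symm h1) h2
  obtain ⟨v1, v2, v3, v4⟩ := lp_tri Bᵀ Qsᵀ Psᵀ hBt hinjs
    (by rw [← Matrix.transpose_mul, hQs, Matrix.transpose_mul, Matrix.diagonal_transpose]; rfl)
    (by rw [← Matrix.transpose_mul, hPQs, Matrix.transpose_one])
    (by rw [← Matrix.transpose_mul, hQPs, Matrix.transpose_one])
  obtain ⟨w1, w2⟩ := lp_hess Aᵀ Qsᵀ Psᵀ hAt v1 v2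
  have hCt : Psᵀ * Aᵀ * Qsᵀ = (Qs * A * Ps)ᵀ := by
    rw [Matrix.transpose_mul, Matrix.transpose_mul, mul_assoc]
  rw [hCt] at w1 w2
  have hC : Qs * A * Ps = (Qs * P) * diagonal (fun i => A i i) * (Q * Ps) := by
    calc Qs * A * Ps = Qs * (A * P) * (Q * Ps) := by
          simp only [mul_assoc]
          rw [← mul_assoc P, hPQ, one_mul]
      _ = _ := by rw [hP]; simp only [mul_assoc]
  have hsym := lp_symm (Q * B * P) (Q * Ps) (Qs * P) (fun i => A i i) (fun i => B i i) hinjs hIrr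
    (by
      calc Q * B * P * (Q * Ps) = Q * (B * Ps) := by
            simp only [mul_assoc]
            rw [← mul_assoc P, hPQ, one_mul]
        _ = _ := by rw [hPs]; simp only [mul_assoc])
    (by
      calc Q * Ps * (Qs * P) = Q * (Ps * Qs) * P := by simp only [mul_assoc]
        _ = 1 := by rw [hPQs, mul_one, hQP])
  rw [← hC] at hsym
  have := lpIrr_of_hess (Qs * A * Ps)ᵀ w1
    (fun i j h => by
      rw [w2 i j h]
      exact mul_ne_zero (mul_ne_zero (v4 i) (hsA j i h)) (v3 j))
    (fun i j _ => hsym j i)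
  simpa using lpIrr_transpose this

theorem lpIrr_cases {d : ℕ} {M : Matrix (Fin (d + 1)) (Fin (d + 1)) K} (h : lpIrr M)
    (i j : Fin (d + 1)) : i = j ∨ (i : ℕ) + 1 = j ∨ (j : ℕ) + 1 = i ∨ M i j = 0 := by
  by_cases h1 : 1 < |((i : ℕ) : ℤ) - ((j : ℕ) : ℤ)|
  · exact Or.inr (Or.inr (Or.inr ((h i j).1 h1)))
  · rw [not_lt, abs_le] at h1
    omega

theorem lp_R_zero {d : ℕ} (A B P Q : Matrix (Fin (d + 1)) (Fin (d + 1)) K) (θ : ℕ → K)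
    (hP : A * P = P * diagonal (fun i : Fin (d + 1) => θ i)) (hPQ : P * Q = 1) (hQP : Q * P = 1)
    (hI : lpIrr (Q * B * P)) {β γ ρ : K} (h : lpAW β γ ρ d θ) :
    lpR (Matrix.toLin' A) (Matrix.toLin' B) β γ ρ = 0 := by
  have hA : A = P * diagonal (fun i : Fin (d + 1) => θ i) * Q := by
    rw [← hP, mul_assoc, hPQ, mul_one]
  have hB : B = P * (Q * B * P) * Q := by
    calc B = (P * Q) * B * (P * Q) := by rw [hPQ]; simp
      _ = _ := by simp only [mul_assoc]
  generalize Q * B * P = M at hI hB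
  generalize hD : diagonal (fun i : Fin (d + 1) => θ i) = D at hA
  have hconj : ∀ X Y : Matrix (Fin (d + 1)) (Fin (d + 1)) K,
      (P * X * Q) * (P * Y * Q) = P * (X * Y) * Q := by
    intro X Y
    calc _ = P * X * (Q * P) * Y * Q := by simp only [mul_assoc]
      _ = _ := by rw [hQP, mul_one]; simp only [mul_assoc]
  have e1 : lpR (Matrix.toLin' A) (Matrix.toLin' B) β γ ρ = Matrix.toLin'
      (A * A * A * B - (β + 1) • (A * A * B * A) + (β + 1) • (A * B * A * A) - B * A * A * A
        - γ • (A * A * B - B * A * A) - ρ • (A * B - B * A)) := by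
    simp only [lpR, map_sub, map_add, map_smul, Matrix.toLin'_mul, Module.End.mul_eq_comp]
  have e2 : (A * A * A * B - (β + 1) • (A * A * B * A) + (β + 1) • (A * B * A * A) - B * A * A * A
        - γ • (A * A * B - B * A * A) - ρ • (A * B - B * A)) =
      P * (D * D * D * M - (β + 1) • (D * D * M * D) + (β + 1) • (D * M * D * D) - M * D * D * D
        - γ • (D * D * M - M * D * D) - ρ • (D * M - M * D)) * Q := by
    rw [hA, hB]
    simp only [hconj, mul_sub, sub_mul, mul_add, add_mul, mul_smul_comm, smul_mul_assoc]
  have e3 : D * D * D * M - (β + 1) • (D * D * M * D) + (β + 1) • (D * M * D * D) - M * D * D * D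
        - γ • (D * D * M - M * D * D) - ρ • (D * M - M * D) = 0 := by
    ext i j
    rw [← hD]
    simp only [Matrix.sub_apply, Matrix.add_apply, Matrix.smul_apply, Matrix.mul_diagonal,
      Matrix.diagonal_mul, Matrix.diagonal_mul_diagonal, smul_eq_mul, Matrix.zero_apply]
    rcases lpIrr_cases hI i j with rfl | hij | hij | h0
    · ring
    · have a := h.1 i (by omega)
      rw [hij] at a
      unfold lpP at a
      linear_combination (M i j * (θ i - θ j)) * a
    · have a := h.1 j (by omega)
      rw [hij] at a
      unfold lpP at a
      linear_combination (M i j * (θ i - θ j)) * a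
    · rw [h0]; ring
  rw [e1, e2, e3]
  simp

def lpZ (θ : ℕ → K) : ℕ → K
  | 0 => 0
  | i + 1 => lpZ θ i - θ i * θ (i + 1) * (θ i - θ (i + 1))

theorem lp_Z_rel {d : ℕ} (A B P Q : Matrix (Fin (d + 1)) (Fin (d + 1)) K) (θ : ℕ → K)
    (hP : A * P = P * diagonal (fun i : Fin (d + 1) => θ i)) (hPQ : P * Q = 1) (hQP : Q * P = 1)
    (hI : lpIrr (Q * B * P)) :
    A * A * B * A - A * B * A * A = (P * diagonal (fun i : Fin (d + 1) => lpZ θ i) * Q) * B -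
      B * (P * diagonal (fun i : Fin (d + 1) => lpZ θ i) * Q) := by
  have hA : A = P * diagonal (fun i : Fin (d + 1) => θ i) * Q := by
    rw [← hP, mul_assoc, hPQ, mul_one]
  have hB : B = P * (Q * B * P) * Q := by
    calc B = (P * Q) * B * (P * Q) := by rw [hPQ]; simp
      _ = _ := by simp only [mul_assoc]
  generalize Q * B * P = M at hI hB
  generalize hD : diagonal (fun i : Fin (d + 1) => θ i) = D at hA
  generalize hZ : diagonal (fun i : Fin (d + 1) => lpZ θ i) = Z
  have hconj : ∀ X Y : Matrix (Fin (d + 1)) (Fin (d + 1)) K,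
      (P * X * Q) * (P * Y * Q) = P * (X * Y) * Q := by
    intro X Y
    calc _ = P * X * (Q * P) * Y * Q := by simp only [mul_assoc]
      _ = _ := by rw [hQP, mul_one]; simp only [mul_assoc]
  rw [hA, hB]
  simp only [hconj]
  rw [← sub_mul, ← mul_sub, ← sub_mul (P * (Z * M)), ← mul_sub P (Z * M)]
  congr 2
  ext i j
  rw [← hD, ← hZ]
  simp only [Matrix.sub_apply, Matrix.mul_diagonal,
      Matrix.diagonal_mul, Matrix.diagonal_mul_diagonal]
  rcases lpIrr_cases hI i j with rfl | hij | hij | h0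
  · ring
  · rw [← hij]
    simp only [lpZ]
    ring
  · rw [← hij]
    simp only [lpZ]
    ring
  · rw [h0]; ring

theorem lp_bandA {d : ℕ} (A : Matrix (Fin (d + 1)) (Fin (d + 1)) K) (hA : LowerBidiagonal A)
    (v : Fin (d + 1) → K) (n : ℕ) (hv : ∀ k : Fin (d + 1), n < k → v k = 0) :
    ∀ k : Fin (d + 1), n + 1 < k → (A *ᵥ v) k = 0 := by
  intro k hk
  rw [Matrix.mulVec, dotProduct]
  refine Finset.sum_eq_zero fun l _ => ?_
  by_cases hl : n < l
  · rw [hv l hl, mul_zero]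
  · rw [hA k l (by omega) (by omega), zero_mul]

theorem lp_bandB {d : ℕ} (B : Matrix (Fin (d + 1)) (Fin (d + 1)) K) (hB : UpperBidiagonal B)
    (v : Fin (d + 1) → K) (n : ℕ) (hv : ∀ k : Fin (d + 1), n < k → v k = 0) :
    ∀ k : Fin (d + 1), n < k → (B *ᵥ v) k = 0 := by
  intro k hk
  rw [Matrix.mulVec, dotProduct]
  refine Finset.sum_eq_zero fun l _ => ?_
  by_cases hl : n < l
  · rw [hv l hl, mul_zero]
  · rw [hB k l (by omega) (by omega), zero_mul]

theorem lp_Z_band {d : ℕ} (A B Z : Matrix (Fin (d + 1)) (Fin (d + 1)) K) (hA : LowerBidiagonal A)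
    (hB : UpperBidiagonal B) (hinj : Function.Injective (fun i => B i i))
    (h : A * A * B * A - A * B * A * A = Z * B - B * Z) (v : Fin (d + 1) → K)
    (hv : ∀ k : Fin (d + 1), 0 < (k : ℕ) → v k = 0) (hBv : B *ᵥ v = B 0 0 • v) :
    ∀ k : Fin (d + 1), 3 < (k : ℕ) → (Z *ᵥ v) k = 0 := by
  have hL : ∀ k : Fin (d + 1), 3 < (k : ℕ) → ((A * A * B * A - A * B * A * A) *ᵥ v) k = 0 := by
    intro k hk
    rw [Matrix.sub_mulVec, Pi.sub_apply]
    simp only [← Matrix.mulVec_mulVec]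
    have a1 := lp_bandA A hA v 0 hv
    rw [lp_bandA A hA _ 2 (lp_bandA A hA _ 1 (lp_bandB B hB _ 1 a1)) k hk,
      lp_bandA A hA _ 2 (lp_bandB B hB _ 2 (lp_bandA A hA _ 1 a1)) k hk, sub_zero]
  intro k
  induction k using WellFoundedGT.induction with
  | _ k ih =>
  intro hk
  have e := hL k hk
  rw [h, Matrix.sub_mulVec, Pi.sub_apply, ← Matrix.mulVec_mulVec, ← Matrix.mulVec_mulVec, hBv,
    Matrix.mulVec_smul, Pi.smul_apply, smul_eq_mul] at e
  have e2 : (B *ᵥ (Z *ᵥ v)) k = B k k * (Z *ᵥ v) k := by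
    rw [Matrix.mulVec, dotProduct, Finset.sum_eq_single k]
    · intro l _ hl
      rcases lt_or_gt_of_ne hl with hl | hl
      · rw [hB k l (by omega) (by omega), zero_mul]
      · rw [ih l hl (by omega), mul_zero]
    · simp
  rw [e2] at e
  have hne : B 0 0 - B k k ≠ 0 := sub_ne_zero.2 fun q => by
    have := hinj q
    rw [← this] at hk
    simp at hk
  exact (mul_eq_zero.1 (by linear_combination e : (B 0 0 - B k k) * (Z *ᵥ v) k = 0)).resolve_left hne

theorem lp_E_exp {d : ℕ} (A : Matrix (Fin (d + 1)) (Fin (d + 1)) K)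
    (hs : ∀ i j : Fin (d + 1), (j : ℕ) + 1 = i → A i j ≠ 0) (hd : 3 ≤ d) (x : Fin (d + 1) → K)
    (hx : ∀ k : Fin (d + 1), 3 < (k : ℕ) → x k = 0) :
    ∃ a0 a1 a2 a3 : K, x = a0 • lpE A 0 + a1 • lpE A 1 + a2 • lpE A 2 + a3 • lpE A 3 := by
  refine ⟨x ⟨0, by omega⟩ / lpC A 0, x ⟨1, by omega⟩ / lpC A 1, x ⟨2, by omega⟩ / lpC A 2,
    x ⟨3, by omega⟩ / lpC A 3, ?_⟩
  have c0 := lpC_ne A hs 0 (by omega)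
  have c1 := lpC_ne A hs 1 (by omega)
  have c2 := lpC_ne A hs 2 (by omega)
  have c3 := lpC_ne A hs 3 (by omega)
  ext ⟨k, hk⟩
  simp only [Pi.add_apply, Pi.smul_apply, smul_eq_mul, lpE]
  by_cases h0 : k = 0
  · subst h0; simp [c0]
  by_cases h1 : k = 1
  · subst h1; simp [c1]
  by_cases h2 : k = 2
  · subst h2; simp [c2]
  by_cases h3 : k = 3
  · subst h3; simp [c3]
  rw [hx ⟨k, hk⟩ (by simp only; omega)]
  simp [h0, h1, h2, h3]

theorem lp_cubic_AW {d : ℕ} (hd : 3 ≤ d) (θ : ℕ → K)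
    (hne : ∀ i j, i ≤ d → j ≤ d → i ≠ j → θ i ≠ θ j) (c0 c1 c2 c3 : K)
    (h : ∀ j, j ≤ d → lpZ θ j = c0 + c1 * θ j + c2 * θ j ^ 2 + c3 * θ j ^ 3) :
    ∃ β γ ρ, lpAW β γ ρ d θ := by
  have h1 : ∀ i, i + 1 ≤ d → θ i * θ (i + 1) = c1 + c2 * (θ i + θ (i + 1)) +
      c3 * (θ i ^ 2 + θ i * θ (i + 1) + θ (i + 1) ^ 2) := by
    intro i hi
    have a := h i (by omega)
    have b := h (i + 1) hi
    simp only [lpZ] at b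
    have hn : θ (i + 1) - θ i ≠ 0 := sub_ne_zero.2 (hne _ _ (by omega) (by omega) (by omega))
    apply mul_left_cancel₀ hn
    linear_combination b - a
  have h2 : ∀ i, i + 2 ≤ d → θ (i + 1) = c2 + c3 * (θ i + θ (i + 1) + θ (i + 2)) := by
    intro i hi
    have a := h1 i (by omega)
    have b := h1 (i + 1) (by omega)
    rw [show i + 1 + 1 = i + 2 by omega] at b
    have hn : θ i - θ (i + 2) ≠ 0 := sub_ne_zero.2 (hne _ _ (by omega) (by omega) (by omega))
    apply mul_left_cancel₀ hn
    linear_combination a - b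
  have hc3 : c3 ≠ 0 := by
    intro h0
    have a := h2 0 (by omega)
    have b := h2 1 (by omega)
    rw [h0] at a b
    refine hne 1 2 (by omega) (by omega) (by omega) ?_
    simp only [zero_add, zero_mul, add_zero, Nat.reduceAdd] at a b
    rw [a, b]
  refine ⟨1 / c3 - 1, -c2 / c3, -c1 / c3, fun i hi => ?_, fun i hi => ?_⟩
  · have a := h1 i hi
    unfold lpP
    field_simp
    linear_combination -a
  · have a := h2 i hi
    field_simp
    linear_combination -a

theorem lp_AW_exists {d : ℕ} (hd : 3 ≤ d) (A B P Q : Matrix (Fin (d + 1)) (Fin (d + 1)) K)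
    (θ θs φ : ℕ → K) (hA : LowerBidiagonal A) (hB : UpperBidiagonal B)
    (hne : ∀ i j, i ≤ d → j ≤ d → i ≠ j → θ i ≠ θ j)
    (hinj : Function.Injective (fun i => B i i)) (hB0 : B 0 0 = θs 0)
    (hs : ∀ i j : Fin (d + 1), (j : ℕ) + 1 = i → A i j ≠ 0)
    (he : lpSpl (Matrix.toLin' A) (Matrix.toLin' B) d θ θs φ (lpE A))
    (hP : A * P = P * diagonal (fun i : Fin (d + 1) => θ i)) (hPQ : P * Q = 1) (hQP : Q * P = 1)
    (hI : lpIrr (Q * B * P)) : ∃ β γ ρ, lpAW β γ ρ d θ := by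
  have hQ := lp_QA A P Q _ hP hPQ hQP
  have hrel := lp_Z_rel A B P Q θ hP hPQ hQP hI
  have hb := lp_Z_band A B _ hA hB hinj hrel (lpE A 0)
    (fun k hk => by simp only [lpE]; rw [if_neg (by omega)])
    (by rw [hB0]; simpa using he.2.1)
  obtain ⟨a0, a1, a2, a3, hx⟩ := lp_E_exp A hs hd _ hb
  have hz : ∀ j : Fin (d + 1), lpZ θ j = a0 + a1 * (θ j - θ 0) + a2 * ((θ j - θ 0) * (θ j - θ 1))
      + a3 * ((θ j - θ 0) * (θ j - θ 1) * (θ j - θ 2)) := by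
    intro j
    have hq := lp_Q0 A P Q θ hs hQP hQ he.1 j
    have e := congrFun (congrArg (fun v => Q *ᵥ v) hx) j
    rw [Matrix.mulVec_mulVec, mul_assoc P, ← mul_assoc Q, hQP, one_mul, ← Matrix.mulVec_mulVec,
      Matrix.mulVec_diagonal, lp_E_zero] at e
    simp only [Matrix.mulVec_add, Matrix.mulVec_smul, Pi.add_apply, Pi.smul_apply, smul_eq_mul] at e
    rw [lp_coord A Q θ θ hQ (lpE A) he.1 1 (by omega) j,
      lp_coord A Q θ θ hQ (lpE A) he.1 2 (by omega) j,
      lp_coord A Q θ θ hQ (lpE A) he.1 3 (by omega) j, lp_E_zero] at e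
    simp only [Finset.prod_range_succ, Finset.prod_range_zero, one_mul] at e
    apply mul_right_cancel₀ hq
    linear_combination e
  refine lp_cubic_AW hd θ hne
    (a0 - a1 * θ 0 + a2 * θ 0 * θ 1 - a3 * θ 0 * θ 1 * θ 2)
    (a1 - a2 * (θ 0 + θ 1) + a3 * (θ 0 * θ 1 + θ 0 * θ 2 + θ 1 * θ 2))
    (a2 - a3 * (θ 0 + θ 1 + θ 2)) a3 fun j hj => ?_
  have := hz ⟨j, by omega⟩
  simp only at this
  rw [this]
  ring

theorem lp_peel {d : ℕ} (Q : Matrix (Fin (d + 1)) (Fin (d + 1)) K) (f : ℕ → Fin (d + 1) → K)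
    (hg : ∀ i, i ≤ d → ∀ j : Fin (d + 1), (Q *ᵥ f i) j = 0 ↔ d < i + j) (i : ℕ) (hi : i ≤ d)
    (w : Fin (d + 1) → K) (hw : w ∈ Submodule.span K (f '' Set.Iio (i + 1)))
    (hw' : ∀ j : Fin (d + 1), d < i + j → (Q *ᵥ w) j = 0) : ∃ c : K, w = c • f i := by
  have key : ∀ m, m ≤ i → w ∈ Submodule.span K (f '' Set.Ico m (i + 1)) := by
    intro m
    induction m with
    | zero =>
      intro _
      have : Set.Ico 0 (i + 1) = Set.Iio (i + 1) := by ext; simp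
      rw [this]; exact hw
    | succ m ih =>
      intro hm
      have h := ih (by omega)
      have hset : Set.Ico m (i + 1) = insert m (Set.Ico (m + 1) (i + 1)) := by
        ext k
        simp only [Set.mem_Ico, Set.mem_insert_iff]
        omega
      rw [hset, Set.image_insert_eq, Submodule.mem_span_insert] at h
      obtain ⟨a, z, hz, rfl⟩ := h
      have hz0 : (Q *ᵥ z) ⟨d - m, by omega⟩ = 0 := by
        clear hw hw' ih
        induction hz using Submodule.span_induction with
        | mem x hx =>
          obtain ⟨k, hk, rfl⟩ := hx
          simp only [Set.mem_Ico] at hk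
          exact (hg k (by omega) _).2 (by simp only; omega)
        | zero => simp
        | add x y _ _ hx hy => rw [Matrix.mulVec_add, Pi.add_apply, hx, hy, add_zero]
        | smul c x _ hx => rw [Matrix.mulVec_smul, Pi.smul_apply, hx, smul_zero]
      have h1 := hw' ⟨d - m, by omega⟩ (by simp only; omega)
      rw [Matrix.mulVec_add, Pi.add_apply, hz0, add_zero, Matrix.mulVec_smul, Pi.smul_apply,
        smul_eq_mul, mul_eq_zero] at h1
      rcases h1 with h1 | h1
      · rw [h1, zero_smul, zero_add]; exact hz
      · have := (hg m (by omega) _).1 h1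
        simp only at this
        omega
  have h := key i le_rfl
  have hset : Set.Ico i (i + 1) = {i} := by
    ext k
    simp only [Set.mem_Ico, Set.mem_singleton_iff]
    omega
  rw [hset, Set.image_singleton, Submodule.mem_span_singleton] at h
  obtain ⟨c, hc⟩ := h
  exact ⟨c, hc.symm⟩

theorem lp_B_span {V : Type*} [AddCommGroup V] [Module K V] (A B : V →ₗ[K] V) {d : ℕ}
    {θ θs φ : ℕ → K} {e : ℕ → V} (he : lpSpl A B d θ θs φ e) (n : ℕ) (hn : n ≤ d) (x : V)
    (hx : x ∈ Submodule.span K (e '' Set.Iio n)) : B x ∈ Submodule.span K (e '' Set.Iio n) := by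
  induction hx using Submodule.span_induction with
  | mem x hx =>
    obtain ⟨i, hi, rfl⟩ := hx
    simp only [Set.mem_Iio] at hi
    cases i with
    | zero =>
      rw [he.2.1]
      exact Submodule.smul_mem _ _ (Submodule.subset_span ⟨0, hi, rfl⟩)
    | succ i =>
      rw [he.2.2 i (by omega)]
      exact Submodule.add_mem _ (Submodule.smul_mem _ _ (Submodule.subset_span ⟨i + 1, hi, rfl⟩))
        (Submodule.smul_mem _ _ (Submodule.subset_span ⟨i, by simp only [Set.mem_Iio]; omega, rfl⟩))
  | zero => simp
  | add x y _ _ hx hy => rw [map_add]; exact Submodule.add_mem _ hx hy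
  | smul c x _ hx => rw [map_smul]; exact Submodule.smul_mem _ _ hx

theorem lp_phip {d : ℕ} (A B P Q : Matrix (Fin (d + 1)) (Fin (d + 1)) K)
    (θ θs φ : ℕ → K) (f : ℕ → Fin (d + 1) → K)
    (he : lpSpl (Matrix.toLin' A) (Matrix.toLin' B) d θ θs φ (lpE A))
    (hf0 : f 0 = lpE A 0)
    (hf : ∀ i, i < d → Matrix.toLin' A (f i) = θ (d - i) • f i + f (i + 1))
    (hPQ : P * Q = 1) (hI : lpIrr (Q * B * P))
    (hg : ∀ i, i ≤ d → ∀ j : Fin (d + 1), (Q *ᵥ f i) j = 0 ↔ d < i + j) (i : ℕ) (hi : i < d) :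
    ∃ c : K, c ≠ 0 ∧ Matrix.toLin' B (f (i + 1)) = θs (i + 1) • f (i + 1) + c • f i := by
  have hspan : Matrix.toLin' B (f (i + 1)) - θs (i + 1) • f (i + 1) ∈
      Submodule.span K (f '' Set.Iio (i + 1)) := by
    apply lp_span_le (Matrix.toLin' A) (θ := fun i => θ (d - i)) hf he.1 hf0.symm (i + 1) (by omega)
    have h1 := lp_span (Matrix.toLin' A) (θ' := fun i => θ (d - i)) he.1 hf hf0 (i + 1) (by omega)
    have h2 := lp_B_span _ _ he (i + 1) (by omega) _ h1
    have h3 : lpE A i ∈ Submodule.span K (lpE A '' Set.Iio (i + 1)) :=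
      Submodule.subset_span ⟨i, by simp, rfl⟩
    have h4 := Submodule.sub_mem _ (Submodule.add_mem _ h2 (Submodule.smul_mem _ (φ (i + 1)) h3))
      (Submodule.smul_mem _ (θs (i + 1)) h1)
    convert h4 using 1
    rw [map_sub, he.2.2 i hi]
    module
  have hQB : ∀ v, Q *ᵥ (B *ᵥ v) = (Q * B * P) *ᵥ (Q *ᵥ v) := by
    intro v
    rw [Matrix.mulVec_mulVec, Matrix.mulVec_mulVec, mul_assoc (Q * B), hPQ, mul_one]
  obtain ⟨c, hc⟩ := lp_peel Q f hg i (by omega) _ hspan (by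
    intro j hj
    rw [Matrix.toLin'_apply, Matrix.mulVec_sub, hQB, Matrix.mulVec_smul, Pi.sub_apply,
      Pi.smul_apply, (hg (i + 1) (by omega) j).2 (by omega), smul_zero, sub_zero, Matrix.mulVec,
      dotProduct]
    refine Finset.sum_eq_zero fun l _ => ?_
    by_cases hl : d < i + 1 + l
    · rw [(hg (i + 1) (by omega) l).2 hl, mul_zero]
    · rw [(hI j l).1 (by rw [lt_abs]; omega), zero_mul])
  refine ⟨c, ?_, by rw [← hc]; simp⟩
  rintro rfl
  rw [zero_smul, Matrix.toLin'_apply] at hc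
  have j0 : d - i < d + 1 := by omega
  have j1 : d - i - 1 < d + 1 := by omega
  have e := congrFun (congrArg (fun v => Q *ᵥ v) hc) ⟨d - i, j0⟩
  rw [Matrix.mulVec_sub, hQB, Matrix.mulVec_smul, Pi.sub_apply,
      Pi.smul_apply, (hg (i + 1) (by omega) ⟨d - i, j0⟩).2 (by simp only; omega), smul_zero,
      sub_zero, Matrix.mulVec_zero, Pi.zero_apply, Matrix.mulVec,
      dotProduct, Finset.sum_eq_single ⟨d - i - 1, j1⟩] at e
  · rcases mul_eq_zero.1 e with e | e
    · exact (hI _ _).2 (by rw [abs_eq (by norm_num)]; simp only; omega) e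
    · have := (hg (i + 1) (by omega) _).1 e
      simp only at this
      omega
  · intro l _ hl
    by_cases hl' : d < i + 1 + l
    · rw [(hg (i + 1) (by omega) l).2 hl', mul_zero]
    · have : (l : ℕ) ≠ d - i - 1 := fun q => hl (Fin.ext q)
      rw [(hI _ l).1 (by rw [lt_abs]; simp only; omega), zero_mul]
  · simp

theorem lp_forw {d : ℕ} (A B : Matrix (Fin (d + 1)) (Fin (d + 1)) K) (hA : LowerBidiagonal A)
    (hB : UpperBidiagonal B) (hLP : IsLeonardPair A B) :
    ∃ θ θs φ φp : ℕ → K, IsParameterArray K d θ θs φ φp ∧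
      (∀ i : Fin (d + 1), A i i = θ i ∧ B i i = θs i) ∧
      (∀ i j : Fin (d + 1), (j : ℕ) + 1 = i → A i j * B j i = φ i) := by
  obtain ⟨⟨θ₁, h1⟩, ⟨θ₂, h2⟩⟩ := hLP
  have hBt : LowerBidiagonal Bᵀ := fun i j h1 h2 => hB j i (Ne.symm h1) h2
  have hAt : UpperBidiagonal Aᵀ := fun i j h1 h2 => hA j i (Ne.symm h1) h2
  obtain ⟨hinj, hsB, P, Q, hP, hPQ, hQP, hI⟩ := lp_standard A B hA hB θ₁ h1
  obtain ⟨hinjs, hsA', -⟩ := lp_standard Bᵀ Aᵀ hBt hAt θ₂ (lp_eigseq_transpose B A θ₂ h2)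
  have hsA : ∀ i j : Fin (d + 1), (j : ℕ) + 1 = i → A i j ≠ 0 := fun i j h => hsA' j i h
  have hinjs' : Function.Injective (fun i => B i i) := hinjs
  let θ : ℕ → K := fun i => lpX A i i
  let θs : ℕ → K := fun i => lpX B i i
  let φ : ℕ → K := fun i => if i = 0 then 0 else lpX A i (i - 1) * lpX B (i - 1) i
  have hX : ∀ (M : Matrix (Fin (d + 1)) (Fin (d + 1)) K) (i j : Fin (d + 1)), lpX M i j = M i j := by
    intro M i j
    unfold lpX
    rw [dif_pos ⟨i.2, j.2⟩]
  have hθ : ∀ i : Fin (d + 1), A i i = θ i := fun i => (hX A i i).symm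
  have hθs : ∀ i : Fin (d + 1), B i i = θs i := fun i => (hX B i i).symm
  have hφ : ∀ i j : Fin (d + 1), (j : ℕ) + 1 = i → A i j * B j i = φ i := by
    intro i j h
    simp only [φ]
    rw [if_neg (by omega), show (i : ℕ) - 1 = j by omega, hX, hX]
  have hne : ∀ i j, i ≤ d → j ≤ d → i ≠ j → θ i ≠ θ j := by
    intro i j hi hj hij h
    have a := hθ ⟨i, by omega⟩
    have b := hθ ⟨j, by omega⟩
    exact hij (congrArg Fin.val (hinj (a.trans (h.trans b.symm))))
  have hnes : ∀ i j, i ≤ d → j ≤ d → i ≠ j → θs i ≠ θs j := by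
    intro i j hi hj hij h
    have a := hθs ⟨i, by omega⟩
    have b := hθs ⟨j, by omega⟩
    exact hij (congrArg Fin.val (hinjs' (a.trans (h.trans b.symm))))
  have he := lp_split A B hA hB θ θs φ hθ hθs hφ
  have hP' : A * P = P * diagonal (fun i : Fin (d + 1) => θ i) := by
    rw [hP]; simp only [hθ]
  have hQ := lp_QA A P Q _ hP' hPQ hQP
  let f := lpF (Matrix.toLin' A) (fun i => θ (d - i)) (lpE A 0)
  have hf0 : f 0 = lpE A 0 := rfl
  have hf : ∀ i, i < d → Matrix.toLin' A (f i) = θ (d - i) • f i + f (i + 1) :=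
    fun i _ => lpF_raise _ _ _ i
  have hg := lp_supp A P Q θ hsA hQP hQ hne he.1 f hf0 hf
  have hex := lp_phip A B P Q θ θs φ f he hf0 hf hPQ hI hg
  choose c hc0 hc using hex
  let φp : ℕ → K := fun i => if h : 1 ≤ i ∧ i ≤ d then c (i - 1) (by omega) else 0
  have hφp : ∀ i (hi : i < d), φp (i + 1) = c i hi := by
    intro i hi
    simp only [φp]
    rw [dif_pos ⟨by omega, by omega⟩]
    rfl
  have hfB : lpSpl (Matrix.toLin' A) (Matrix.toLin' B) d (fun i => θ (d - i)) θs φp f := by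
    refine ⟨hf, he.2.1, fun i hi => ?_⟩
    rw [hφp i hi]
    exact hc i hi
  obtain ⟨F1, F2, F3⟩ := lp_F _ _ he hf0 hfB (fun h => hne 0 d (by omega) le_rfl (by omega))
    (by simp [φ]) (by simp [φp])
    (fun i j hi hj hij a b h => lp_E_li A hsA i j hi hj hij a b h)
    (fun i hi h0 => by
      have := (hg i hi 0).1 (by rw [h0]; simp)
      simp only [Fin.val_zero] at this
      omega)
    (fun hd => by
      obtain ⟨β, γ, ρ, h⟩ := lp_AW_exists hd A B P Q θ θs φ hA hB hne hinjs' (hθs 0) hsA he hP'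
        hPQ hQP hI
      exact ⟨β, γ, ρ, h, lp_R_zero A B P Q θ hP' hPQ hQP hI h⟩)
  refine ⟨θ, θs, φ, φp, ⟨?_, ?_, ?_, ?_, ?_⟩, fun i => ⟨hθ i, hθs i⟩, hφ⟩
  · intro i hi hid
    refine ⟨?_, ?_⟩
    · have := hφ ⟨i, by omega⟩ ⟨i - 1, by omega⟩ (by simp only; omega)
      simp only at this
      rw [← this]
      exact mul_ne_zero (hsA _ _ (by simp only; omega)) (hsB _ _ (by simp only; omega))
    · have := hφp (i - 1) (by omega)
      rw [show i - 1 + 1 = i by omega] at this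
      rw [this]
      exact hc0 _ _
  · exact fun i j hi hj h => ⟨hne i j hi hj h, hnes i j hi hj h⟩
  · exact fun i _ hi => F1 i hi
  · intro i h1 hi
    rw [show d - i + 1 = d - (i - 1) by omega]
    exact F2 i hi
  · by_cases hd : 3 ≤ d
    · obtain ⟨β, γ, ρ, h, hs⟩ := F3 hd
      have r1 := (lp_div_iff (b := β + 1) hne).2 (lp_AW_lin h)
      have r2 := (lp_div_iff (b := β + 1) hnes).2 hs
      exact ⟨β + 1, fun i h2 h3 => ⟨r1 i h2 h3, r2 i h2 h3⟩⟩
    · exact ⟨0, fun i h2 h3 => absurd h3 (by omega)⟩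


/-- recognition of a Leonard pair with `A` lower bidiagonal
and `A*` upper bidiagonal. -/
theorem leonard_lbub_iff {d : ℕ}
    (A Astar : Matrix (Fin (d + 1)) (Fin (d + 1)) K)
    (hLB : LowerBidiagonal A) (hUB : UpperBidiagonal Astar) :
    IsLeonardPair A Astar ↔
      ∃ θ θs φ φp : ℕ → K, IsParameterArray K d θ θs φ φp ∧
        (∀ i : Fin (d + 1), A i i = θ (i : ℕ) ∧ Astar i i = θs (i : ℕ)) ∧
        (∀ i : ℕ, ∀ _ : 1 ≤ i, ∀ _ : i ≤ d,
          A ⟨i, by omega⟩ ⟨i - 1, by omega⟩ * Astar ⟨i - 1, by omega⟩ ⟨i, by omega⟩ = φ i) := by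
  constructor
  · intro h
    obtain ⟨θ, θs, φ, φp, hp, h1, h2⟩ := lp_forw A Astar hLB hUB h
    exact ⟨θ, θs, φ, φp, hp, h1, fun i hi hd => h2 ⟨i, by omega⟩ ⟨i - 1, by omega⟩
      (by simp only; omega)⟩
  · rintro ⟨θ, θs, φ, φp, hp, h1, h2⟩
    refine lp_back A Astar hLB hUB θ θs φ φp hp (fun i => (h1 i).1) (fun i => (h1 i).2) ?_
    intro i j h
    have a := h2 i (by omega) (by omega)
    have hj : (⟨(i : ℕ) - 1, by omega⟩ : Fin (d + 1)) = j := by ext; simp only; omega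
    rw [← hj]
    exact a
end

section
/- Let p = (θ_i, θ*_i, i=0..d; φ_j, φ'_j, j=1..d) be a parameter array over K. Define the tridiagonal matrix p^T ∈ Mat_{d+1}(K) by p^T_{ii} = θ_i + φ_i/(θ*_i-θ*_{i-1}) + φ_{i+1}/(θ*_i-θ*_{i+1}) (with φ_0 = φ_{d+1} = 0 and the empty terms omitted for i = 0, d), p^T_{i-1,i} = φ_i ∏_{h=0}^{i-2}(θ*_{i-1}-θ*_h)/∏_{h=0}^{i-1}(θ*_i-θ*_h), and p^T_{i,i-1} = φ'_i ∏_{h=i+1}^{d}(θ*_i-θ*_h)/∏_{h=i}^{d}(θ*_{i-1}-θ*_h). Then p^T has constant row sum θ_0. -/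
open Finset

def TT {K : Type*} [Field K] (B : K) (n : ℕ) : K := if Even n then B else 1

def ww {K : Type*} [Field K] (B : K) : ℕ → K
  | 0 => 0
  | 1 => 1
  | (n+2) => TT B (n+1) * ww B (n+1) - ww B n

def SS {K : Type*} [Field K] (B s1 s2 : K) : ℕ → K
  | 0 => B * s1 - s2
  | 1 => s1
  | (n+2) => TT B n * SS B s1 s2 (n+1) - SS B s1 s2 n

set_option linter.unusedSimpArgs false

section
variable {K : Type*} [Field K] (B : K)

lemma TT_even {n : ℕ} (h : Even n) : TT B n = B := by simp [TT, h]
lemma TT_odd {n : ℕ} (h : Odd n) : TT B n = 1 := by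
  simp [TT, Nat.not_even_iff_odd.mpr h]
lemma ww_rec (n : ℕ) : ww B (n+2) = TT B (n+1) * ww B (n+1) - ww B n := by rw [ww]

variable (S : ℕ → K) (hS : ∀ n, S (n+2) = TT B n * S (n+1) - S n)
include hS

lemma up_both (k : ℕ) : ∀ n : ℕ,
    (Even (n+k) → S (n+1+k) = ww B (k+1) * S (n+1) - ww B k * S n) ∧
    (Odd (n+k) → S (n+1+k) = TT B (k+1) * ww B (k+1) * S (n+1) - TT B k * ww B k * S n) := by
  induction k with
  | zero => 
    intro n
    simp [ww, TT]
  | succ k ih =>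
    intro n
    obtain ⟨h1, h2⟩ := ih (n+1)
    have e : n + 1 + (k+1) = n + 1 + 1 + k := by ring
    rw [e, ww_rec]
    have hs := hS n
    rcases em (Even n) with hn | hn <;> rcases em (Even k) with hk | hk <;>
    (constructor <;> intro h <;> first 
      | (exfalso; revert h hn hk; simp only [Nat.even_iff, Nat.odd_iff]; omega) 
      | skip) <;>
    (first 
     | have g := h1 (by revert h hn hk; simp only [Nat.even_iff, Nat.odd_iff]; omega)
     | have g := h2 (by revert h hn hk; simp only [Nat.even_iff, Nat.odd_iff]; omega)) <;>
    rw [g, hs] <;>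
    simp only [TT, hn, hk, Nat.even_add_one, if_true, if_false, not_true_eq_false, not_false_eq_true] <;> ring

lemma down_both (k : ℕ) : ∀ n : ℕ,
    (Odd n → S n = ww B (k+1) * S (n+k) - ww B k * S (n+k+1)) ∧
    (Even n → S n = TT B (k+1) * ww B (k+1) * S (n+k) - TT B k * ww B k * S (n+k+1)) := by
  induction k with
  | zero => 
    intro n
    simp [ww, TT]
  | succ k ih =>
    intro n
    obtain ⟨h1, h2⟩ := ih n
    have hs := hS (n+k)
    have e : n + (k+1) = n + k + 1 := by ring
    have e2 : n + k + 1 + 1 = n + k + 2 := by ring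
    rw [e, e2, ww_rec, hs]
    rcases em (Even n) with hn | hn <;> rcases em (Even k) with hk | hk <;>
    (constructor <;> intro h <;> first 
      | (exfalso; revert h hn; simp only [Nat.even_iff, Nat.odd_iff]; omega) 
      | skip) <;>
    (first 
     | have g := h1 h
     | have g := h2 h) <;>
    rw [g] <;>
    simp only [TT, hn, hk, Nat.even_add, Nat.even_add_one, if_true, if_false, not_true_eq_false, not_false_eq_true, iff_true, iff_false, iff_self] <;> ring

lemma sum_odd (N k : ℕ) (hN : Odd N) :
    ∑ h ∈ range k, S (N + 2*h) = ww B k * S (N + k - 1) := by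
  induction k with
  | zero => simp [ww]
  | succ k ih =>
    obtain ⟨N, rfl⟩ : ∃ M, N = M + 1 := ⟨N - 1, by have := hN.pos; omega⟩
    rw [sum_range_succ, ih]
    have g := (up_both B S hS k (N+k)).1 (by revert hN; simp only [Nat.even_iff, Nat.odd_iff]; omega)
    have e : N + 1 + 2 * k = N + k + 1 + k := by ring
    have e1 : N + 1 + (k+1) - 1 = N + k + 1 := by omega
    have e2 : N + 1 + k - 1 = N + k := by omega
    rw [e, e1, e2, g]; ring

lemma sum_even (N k : ℕ) (hN : Even N) (hN0 : 0 < N) :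
    ∑ h ∈ range k, S (N + 2*h) = TT B k * ww B k * S (N + k - 1) := by
  induction k with
  | zero => simp [ww]
  | succ k ih =>
    obtain ⟨N, rfl⟩ : ∃ M, N = M + 1 := ⟨N - 1, by omega⟩
    rw [sum_range_succ, ih]
    have g := (up_both B S hS k (N+k)).2 (by revert hN; simp only [Nat.even_iff, Nat.odd_iff]; omega)
    have e : N + 1 + 2 * k = N + k + 1 + k := by ring
    have e1 : N + 1 + (k+1) - 1 = N + k + 1 := by omega
    have e2 : N + 1 + k - 1 = N + k := by omega
    rw [e, e1, e2, g]; ring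

omit hS in
lemma prodP (i k : ℕ) (hk : k ≤ i) :
    (∏ h ∈ range k, (ww B (i-h) * S (i+h))) * (ww B (i+1) * S (i+k)) =
    S i * ww B (i+1-k) * ∏ h ∈ range k, (ww B (i+1-h) * S (i+1+h)) := by
  induction k with
  | zero => simp; ring
  | succ k ih =>
    have := ih (by omega)
    rw [prod_range_succ, prod_range_succ]
    have e : i + 1 - (k+1) = i - k := by omega
    have e1 : i + (k+1) = i+1+k := by omega
    rw [e, e1]
    linear_combination ww B (i-k) * S (i+1+k) * this

omit hS in
lemma prodQ (n m : ℕ) :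
    (∏ k ∈ range m, (ww B (k+1) * S (n+1+k))) * (ww B (m+1) * S n) =
    S (n+m) * ∏ k ∈ range m, (ww B (k+2) * S (n+k)) := by
  induction m with
  | zero => simp [ww]
  | succ m ih =>
    rw [prod_range_succ, prod_range_succ]
    have e1 : n + (m+1) = n+1+m := by omega
    rw [e1]
    linear_combination ww B (m+2) * S (n+1+m) * ih

lemma oneP (i : ℕ) : ww B (i+1) * S (2*i) - S i = TT B i * ww B i * S (2*i+1) := by
  have := down_both B S hS i i
  rw [show i + i = 2*i by ring] at this
  rcases Nat.even_or_odd i with h | h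
  · rw [this.2 h, TT_odd B h.add_one]; ring
  · rw [this.1 h, TT_odd B h]; ring

lemma oneQ (j m : ℕ) : ww B (m+1) * S (2*j+2) - S (2*j+2+m) = TT B m * ww B m * S (2*j+1) := by
  have := up_both B S hS m (2*j+1)
  rcases Nat.even_or_odd m with h | h
  · rw [this.2 (by revert h; simp only [Nat.even_iff, Nat.odd_iff]; omega), TT_odd B h.add_one]; ring
  · rw [this.1 (by revert h; simp only [Nat.even_iff, Nat.odd_iff]; omega), TT_odd B h]; ring

variable (R : ℕ → K) (hR : ∀ n, R (n+2) = TT B n * R (n+1) - R n)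
include hR

lemma key (j m : ℕ) :
    S (2*j+2+m) * ((if Odd m then TT B (j+1) else 1) * S 1 * R (j+1+m) - S (j+1) * R (m+1))
    + R (j+1) * S (2*j+2) * S (2*j+1) - S (j+1) * S (2*j+2) * ww B (m+1) * R (2*j+1+m)
    + TT B (j+1) * S (j+2) * S (2*j+1) * ww B m * R (2*j+2+m) = 0 := by
  have a1 := up_both B S hS m (2*j+1)
  have a2 := up_both B S hS j (j+1)
  have a3 := up_both B S hS (j+1) (j+1)
  have a4 := hS (2*j+1)
  have a5 := down_both B S hS j 1
  have b1 := down_both B R hR m (j+1)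
  have b2 := down_both B R hR j (m+1)
  have b3 := up_both B R hR j (j+1+m)
  have b4 := up_both B R hR (j+1) (j+1+m)
  have b5 := hR (2*j+1+m)
  have ev2 : Odd (j+1+j) := by simp only [Nat.odd_iff]; omega
  rw [ww_rec] at a3 b4
  have e1 : j + 1 + 1 + j = 2*j+2 := by ring
  have e2 : j + 1 + 1 + (j+1) = 2*j+3 := by ring
  have e3 : 2*j+1+1 = 2*j+2 := by ring
  have e3' : 2*j+1+2 = 2*j+3 := by ring
  have e4 : m + 1 + j = j + 1 + m := by ring
  have e5 : j + 1 + m + 1 + j = 2*j+2+m := by ring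
  have e6 : j + 1 + m + 1 + (j+1) = 2*j+3+m := by ring
  have e7 : 2*j+1+m+1 = 2*j+2+m := by ring
  have e8 : 2*j+1+m+2 = 2*j+3+m := by ring
  have e9 : 1 + j = j+1 := by ring
  rw [e9] at a5
  rw [e3] at a1
  rw [e1] at a2
  rw [e2] at a3
  rw [e3, e3'] at a4
  rw [e4] at b2
  rw [e5] at b3
  rw [e6] at b4
  rw [e7, e8] at b5
  have o1 : Odd (2*j+1) := odd_two_mul_add_one j
  replace a2 := a2.2 ev2
  replace a3 := a3.1 (by simp only [Nat.even_iff]; omega)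
  replace a5 := a5.1 odd_one
  rw [TT_odd B o1] at a4
  have hw := ww_rec B j
  rcases Nat.even_or_odd j with hj | hj <;> rcases Nat.even_or_odd m with hm | hm
  · replace a1 := a1.2 (by revert hj hm; simp only [Nat.even_iff, Nat.odd_iff]; omega)
    replace b1 := b1.1 (by revert hj hm; simp only [Nat.even_iff, Nat.odd_iff]; omega)
    replace b2 := b2.1 (by revert hj hm; simp only [Nat.even_iff, Nat.odd_iff]; omega)
    replace b3 := b3.2 (by revert hj hm; simp only [Nat.even_iff, Nat.odd_iff]; omega)
    replace b4 := b4.1 (by revert hj hm; simp only [Nat.even_iff, Nat.odd_iff]; omega)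
    have o2 : Odd (2*j+1+m) := (by revert hj hm; simp only [Nat.even_iff, Nat.odd_iff]; omega)
    have hm2 : ¬ Odd m := (by revert hj hm; simp only [Nat.even_iff, Nat.odd_iff]; omega)
    have o3 : Even (j+1+1) := (by revert hj hm; simp only [Nat.even_iff, Nat.odd_iff]; omega)
    rw [TT_odd B o2] at b5
    simp only [TT_even B hj, TT_even B o3, TT_odd B hj.add_one, TT_even B hm, TT_odd B hm.add_one, one_mul] at a1 a2 a3 b1 b2 b3 b4 ⊢
    simp only [hm2, if_true, if_false]
    have a6 : S (2*j+1) = S (2*j+2) - S (2*j+3) := by linear_combination a4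
    have b6 : R (2*j+1+m) = R (2*j+2+m) - R (2*j+3+m) := by linear_combination b5
    rw [b6, b4, b3, b2, b1, a1, a6, a5, a3, a2]
    ring
  · replace a1 := a1.1 (by revert hj hm; simp only [Nat.even_iff, Nat.odd_iff]; omega)
    replace b1 := b1.1 (by revert hj hm; simp only [Nat.even_iff, Nat.odd_iff]; omega)
    replace b2 := b2.2 (by revert hj hm; simp only [Nat.even_iff, Nat.odd_iff]; omega)
    replace b3 := b3.1 (by revert hj hm; simp only [Nat.even_iff, Nat.odd_iff]; omega)
    replace b4 := b4.2 (by revert hj hm; simp only [Nat.even_iff, Nat.odd_iff]; omega)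
    have o2 : Even (2*j+1+m) := (by revert hj hm; simp only [Nat.even_iff, Nat.odd_iff]; omega)
    have hm2 : Odd m := (by revert hj hm; simp only [Nat.even_iff, Nat.odd_iff]; omega)
    have o3 : Even (j+1+1) := (by revert hj hm; simp only [Nat.even_iff, Nat.odd_iff]; omega)
    rw [TT_even B o2] at b5
    simp only [TT_even B hj, TT_even B o3, TT_odd B hj.add_one, TT_odd B hm, TT_even B hm.add_one, one_mul] at a1 a2 a3 b1 b2 b3 b4 ⊢
    simp only [hm2, if_true, if_false]
    have a6 : S (2*j+1) = S (2*j+2) - S (2*j+3) := by linear_combination a4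
    have b6 : R (2*j+1+m) = B * R (2*j+2+m) - R (2*j+3+m) := by linear_combination b5
    rw [b6, b4, b3, b2, b1, a1, a6, a5, a3, a2]
    ring
  · replace a1 := a1.2 (by revert hj hm; simp only [Nat.even_iff, Nat.odd_iff]; omega)
    replace b1 := b1.2 (by revert hj hm; simp only [Nat.even_iff, Nat.odd_iff]; omega)
    replace b2 := b2.1 (by revert hj hm; simp only [Nat.even_iff, Nat.odd_iff]; omega)
    replace b3 := b3.2 (by revert hj hm; simp only [Nat.even_iff, Nat.odd_iff]; omega)
    replace b4 := b4.1 (by revert hj hm; simp only [Nat.even_iff, Nat.odd_iff]; omega)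
    have o2 : Odd (2*j+1+m) := (by revert hj hm; simp only [Nat.even_iff, Nat.odd_iff]; omega)
    have hm2 : ¬ Odd m := (by revert hj hm; simp only [Nat.even_iff, Nat.odd_iff]; omega)
    have o3 : Odd (j+1+1) := (by revert hj hm; simp only [Nat.even_iff, Nat.odd_iff]; omega)
    rw [TT_odd B o2] at b5
    simp only [TT_odd B hj, TT_odd B o3, TT_even B hj.add_one, TT_even B hm, TT_odd B hm.add_one, one_mul] at a1 a2 a3 b1 b2 b3 b4 ⊢
    simp only [hm2, if_true, if_false]
    have a6 : S (2*j+1) = S (2*j+2) - S (2*j+3) := by linear_combination a4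
    have b6 : R (2*j+1+m) = R (2*j+2+m) - R (2*j+3+m) := by linear_combination b5
    rw [b6, b4, b3, b2, b1, a1, a6, a5, a3, a2]
    ring
  · replace a1 := a1.1 (by revert hj hm; simp only [Nat.even_iff, Nat.odd_iff]; omega)
    replace b1 := b1.2 (by revert hj hm; simp only [Nat.even_iff, Nat.odd_iff]; omega)
    replace b2 := b2.2 (by revert hj hm; simp only [Nat.even_iff, Nat.odd_iff]; omega)
    replace b3 := b3.1 (by revert hj hm; simp only [Nat.even_iff, Nat.odd_iff]; omega)
    replace b4 := b4.2 (by revert hj hm; simp only [Nat.even_iff, Nat.odd_iff]; omega)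
    have o2 : Even (2*j+1+m) := (by revert hj hm; simp only [Nat.even_iff, Nat.odd_iff]; omega)
    have hm2 : Odd m := (by revert hj hm; simp only [Nat.even_iff, Nat.odd_iff]; omega)
    have o3 : Odd (j+1+1) := (by revert hj hm; simp only [Nat.even_iff, Nat.odd_iff]; omega)
    rw [TT_even B o2] at b5
    simp only [TT_odd B hj, TT_odd B o3, TT_even B hj.add_one, TT_odd B hm, TT_even B hm.add_one, one_mul] at a1 a2 a3 b1 b2 b3 b4 ⊢
    simp only [hm2, if_true, if_false]
    have a6 : S (2*j+1) = S (2*j+2) - S (2*j+3) := by linear_combination a4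
    have b6 : R (2*j+1+m) = B * R (2*j+2+m) - R (2*j+3+m) := by linear_combination b5
    rw [b6, b4, b3, b2, b1, a1, a6, a5, a3, a2]
    ring

omit hR hS in
lemma diffs (b : K) (d : ℕ) (y : ℕ → K)
    (h : ∀ n, n + 3 ≤ d → y n - y (n+3) = b * (y (n+1) - y (n+2))) :
    ∃ S : ℕ → K, (∀ n, S (n+2) = TT (b+1) n * S (n+1) - S n) ∧
      ∀ j k, j + k ≤ d → y (j+k) - y j = ww (b+1) k * S (2*j+k) := by
  refine ⟨SS (b+1) (y 1 - y 0) (y 2 - y 0), fun n => by rw [SS], ?_⟩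
  set S := SS (b+1) (y 1 - y 0) (y 2 - y 0) with hSd
  have hS : ∀ n, S (n+2) = TT (b+1) n * S (n+1) - S n := fun n => by rw [hSd, SS]
  have st : ∀ n, (n + 1 ≤ d → S (2*n+1) = y (n+1) - y n) ∧
      (n + 2 ≤ d → S (2*n+2) = y (n+2) - y n) := by
    intro n
    induction n with
    | zero =>
      constructor
      · intro _; simp [hSd, SS]
      · intro _; simp [hSd, SS, TT]
    | succ n ih =>
      obtain ⟨i1, i2⟩ := ih
      have c1 : n + 1 + 1 ≤ d → S (2*(n+1)+1) = y (n+1+1) - y (n+1) := by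
        intro hd
        have := hS (2*n+1)
        rw [TT_odd _ (odd_two_mul_add_one n), i1 (by omega), show 2*n+1+1 = 2*n+2 by ring,
          i2 (by omega)] at this
        rw [show 2*(n+1)+1 = 2*n+1+2 by ring, this]; ring
      refine ⟨c1, ?_⟩
      intro hd
      have := hS (2*n+2)
      rw [TT_even _ (by simp [Nat.even_add]), show 2*n+2+1 = 2*(n+1)+1 by ring, c1 (by omega),
          i2 (by omega)] at this
      rw [show 2*(n+1)+2 = 2*n+2+2 by ring, this]
      linear_combination h n (by omega)
  intro j k hjk
  have e := sum_odd (b+1) S hS (2*j+1) k (odd_two_mul_add_one j)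
  rw [show 2*j+1+k-1 = 2*j+k by omega] at e
  rw [← e]
  have := Finset.sum_range_sub (fun h => y (j+h)) k
  simp only [add_zero] at this
  rw [← this]
  apply Finset.sum_congr rfl
  intro h hh
  rw [mem_range] at hh
  rw [show 2*j+1+2*h = 2*(j+h)+1 by ring, (st (j+h)).1 (by omega), add_assoc]

omit hR hS in
lemma rowsum (d i : ℕ) (hi : i ≤ d) (A : K) (C D : ℕ → K) :
    ∑ j ∈ range (d+1), (if i = j then A else if j = i + 1 then C j else if i = j + 1 then D j else 0)
    = A + (if i + 1 ≤ d then C (i+1) else 0) + (if 1 ≤ i then D (i-1) else 0) := by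
  have : ∀ j ∈ range (d+1), (if i = j then A else if j = i + 1 then C j else if i = j + 1 then D j else 0)
     = (if i = j then A else 0) + (if i + 1 = j then C j else 0) + (if i - 1 = j then (if 1 ≤ i then D j else 0) else 0) := by
    intro j _
    split_ifs <;> first | omega | simp
  rw [sum_congr rfl this, sum_add_distrib, sum_add_distrib, sum_ite_eq, sum_ite_eq, sum_ite_eq]
  have h1 : i ∈ range (d+1) := by simp; omega
  have h2 : i - 1 ∈ range (d+1) := by simp; omega
  simp only [h1, h2, if_true, mem_range, Nat.lt_succ_iff]

omit hR hS in
lemma theta_sum (d i m : ℕ) (hd : d + 1 = i + (m + 1)) (hx : ∀ j k, j + k ≤ d → R (j+k) - R j = ww B k * S (2*j+k))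
    (hS : ∀ n, S (n+2) = TT B n * S (n+1) - S n) :
    ∑ h ∈ range i, (R h - R (d-h)) = - ((if Odd m then TT B i else 1) * ww B i * ww B (m+1) * S d) := by
  rw [sum_sub_distrib]
  have e1 : ∑ h ∈ range i, R (d-h) = ∑ h ∈ range i, R (h + (m+1)) := by
    rw [← sum_range_reflect]
    apply sum_congr rfl
    intro h hh
    rw [mem_range] at hh
    congr 1; omega
  rw [e1, ← neg_sub, ← sum_sub_distrib]
  congr 1
  have e2 : ∑ h ∈ range i, (R (h + (m+1)) - R h) = ∑ h ∈ range i, ww B (m+1) * S (m+1+2*h) := by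
    apply sum_congr rfl
    intro h hh
    rw [mem_range] at hh
    rw [hx _ _ (by omega), add_comm (2*h)]
  rw [e2, ← mul_sum]
  rcases Nat.even_or_odd m with hm | hm
  · rw [sum_odd B S hS _ _ hm.add_one, if_neg (by simpa using hm), show m+1+i-1 = d by omega]; ring
  · rw [sum_even B S hS _ _ hm.add_one (by omega), if_pos hm, show m+1+i-1 = d by omega]; ring

omit hR hS in
lemma mid_alg (f c c' Ti Tm w w1 wm wm1 S1 Si Si1 S2m S2 S2p S2im Rd Ri Rm1 Rdm Rdp p p1 pp : K)
    (h1 : w1 * S2 - Si = Ti * w * S2p) (h2 : wm1 * S2 - S2im = Tm * wm * S2m)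
    (hc : c * Tm = c' * Ti)
    (hk : S2im * (c * S1 * Rd - Si * Rm1) + Ri * S2 * S2m - Si * S2 * wm1 * Rdm
      + Ti * Si1 * S2m * wm * Rdp = 0)
    (hp : p = f * c * w * wm1 - w * Si * (wm1 * Rdm))
    (hp1 : p1 = f * c' * w1 * wm - w1 * Si1 * (wm * Rdp))
    (hpp : pp = (f - S1 * Rd) * c * w * wm1 + w * Si * (wm1 * Rm1))
    (n1 : w1 ≠ 0) (n2 : wm1 ≠ 0) (n3 : S2m ≠ 0) (n4 : S2 ≠ 0) (n5 : S2p ≠ 0) :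
    w * Ri + p / S2m - p1 / S2p + p1 * (Si / (w1 * S2 * S2p)) - pp * (S2im / (wm1 * S2 * S2m)) = 0 := by
  have e1 : p1 / S2p - p1 * (Si / (w1 * S2 * S2p)) = (f * c' * wm - Si1 * (wm * Rdp)) * Ti * w / S2 := by
    have : Si = w1 * S2 - Ti * w * S2p := by linear_combination -h1
    rw [this, hp1]; field_simp; ring
  have e2 : pp * (S2im / (wm1 * S2 * S2m)) = ((f - S1 * Rd) * c * w + w * Si * Rm1) * S2im / (S2 * S2m) := by
    rw [hpp]; field_simp
  have e3 : w * Ri + p / S2m - (f * c' * wm - Si1 * (wm * Rdp)) * Ti * w / S2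
      - ((f - S1 * Rd) * c * w + w * Si * Rm1) * S2im / (S2 * S2m) = 0 := by
    rw [hp]; field_simp
    linear_combination w * hk + f * c * w * h2 + f * w * wm * S2m * hc
  linear_combination e3 - e1 - e2
end

/-- the tridiagonal matrix `p^T` of a parameter array has constant
row sum `θ 0`. -/
theorem pT_constant_row_sum {K : Type*} [Field K] (d : ℕ)
    (θ θs φ φp : ℕ → K) (hpa : IsParameterArray K d θ θs φ φp)
    (hφ0 : φ 0 = 0) (hφd1 : φ (d + 1) = 0)
    (T : Matrix (Fin (d + 1)) (Fin (d + 1)) K)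
    (hT : ∀ i j : Fin (d + 1), T i j =
      if (i : ℕ) = (j : ℕ) then
        θ (i : ℕ) + φ (i : ℕ) / (θs (i : ℕ) - θs ((i : ℕ) - 1))
          + φ ((i : ℕ) + 1) / (θs (i : ℕ) - θs ((i : ℕ) + 1))
      else if (j : ℕ) = (i : ℕ) + 1 then
        φ (j : ℕ) * (∏ h ∈ Finset.range ((j : ℕ) - 1), (θs ((j : ℕ) - 1) - θs h)) /
          (∏ h ∈ Finset.range (j : ℕ), (θs (j : ℕ) - θs h))
      else if (i : ℕ) = (j : ℕ) + 1 then
        φp (i : ℕ) * (∏ h ∈ Finset.Icc ((i : ℕ) + 1) d, (θs (i : ℕ) - θs h)) /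
          (∏ h ∈ Finset.Icc (i : ℕ) d, (θs ((i : ℕ) - 1) - θs h))
      else 0) :
    ∀ i : Fin (d + 1), ∑ j, T i j = θ 0 := by
  obtain ⟨hnz, hdist, hφ, hφp, b, hb⟩ := hpa
  have hx3 : ∀ n, n + 3 ≤ d → θ n - θ (n+3) = b * (θ (n+1) - θ (n+2)) := by
    intro n hn
    have := (hb (n+2) (by omega) (by omega)).1
    rw [div_eq_iff (sub_ne_zero.mpr (hdist _ _ (by omega) (by omega) (by omega)).1)] at this
    exact this
  have hy3 : ∀ n, n + 3 ≤ d → θs n - θs (n+3) = b * (θs (n+1) - θs (n+2)) := by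
    intro n hn
    have := (hb (n+2) (by omega) (by omega)).2
    rw [div_eq_iff (sub_ne_zero.mpr (hdist _ _ (by omega) (by omega) (by omega)).2)] at this
    exact this
  obtain ⟨R, hR, hx⟩ := diffs b d θ hx3
  obtain ⟨S, hS, hy⟩ := diffs b d θs hy3
  set B := b + 1 with hB
  have hwS : ∀ j k, j + k ≤ d → 1 ≤ k → ww B k * S (2*j+k) ≠ 0 := by
    intro j k h1 h2
    rw [← hy j k h1]
    exact sub_ne_zero.mpr (hdist _ _ (by omega) (by omega) (by omega)).2
  have hwR : ∀ j k, j + k ≤ d → 1 ≤ k → ww B k * R (2*j+k) ≠ 0 := by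
    intro j k h1 h2
    rw [← hx j k h1]
    exact sub_ne_zero.mpr (hdist _ _ (by omega) (by omega) (by omega)).1
  have hth : ∀ i m, d + 1 = i + (m+1) → 1 ≤ d →
      ∑ h ∈ range i, (θ h - θ (d-h)) / (θ 0 - θ d) =
      (if Odd m then TT B i else 1) * ww B i * ww B (m+1) / ww B d := by
    intro i m h1 h2
    rw [← sum_div, theta_sum B R θ d i m h1 hx hR]
    have h0 := hx 0 d (by omega)
    have h0' := hwR 0 d (by omega) h2
    simp only [mul_zero, zero_add] at h0 h0'
    rw [← neg_sub, h0]
    have := left_ne_zero_of_mul h0'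
    have := right_ne_zero_of_mul h0'
    field_simp
  intro i'
  obtain ⟨i, hi⟩ := i'
  simp only [hT]
  rw [Fin.sum_univ_eq_sum_range (fun j => if i = j then
        θ i + φ i / (θs i - θs (i - 1)) + φ (i + 1) / (θs i - θs (i + 1))
      else if j = i + 1 then
        φ j * (∏ h ∈ Finset.range (j - 1), (θs (j - 1) - θs h)) /
          (∏ h ∈ Finset.range j, (θs j - θs h))
      else if i = j + 1 then
        φp i * (∏ h ∈ Finset.Icc (i + 1) d, (θs i - θs h)) /
          (∏ h ∈ Finset.Icc i d, (θs (i - 1) - θs h))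
      else 0) (d+1)]
  rw [rowsum d i (by omega) _ (fun j => φ j * (∏ h ∈ Finset.range (j - 1), (θs (j - 1) - θs h)) /
          (∏ h ∈ Finset.range j, (θs j - θs h))) (fun _ => φp i * (∏ h ∈ Finset.Icc (i + 1) d, (θs i - θs h)) /
          (∏ h ∈ Finset.Icc i d, (θs (i - 1) - θs h)))]
  simp only [Nat.add_sub_cancel]
  rcases Nat.eq_zero_or_pos i with rfl | hi0
  · rcases Nat.eq_zero_or_pos d with rfl | hd0
    · simp at hφd1
      simp [hφ0, hφd1]
    · have : θs 1 - θs 0 ≠ 0 := sub_ne_zero.mpr (hdist _ _ (by omega) (by omega) (by omega)).2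
      have h2 : θs 0 - θs 1 ≠ 0 := sub_ne_zero.mpr (hdist _ _ (by omega) (by omega) (by omega)).2
      rw [if_pos (by omega), if_neg (by omega)]
      simp [hφ0]
      rw [← neg_sub (θs 1), div_neg]; ring
  obtain ⟨j, rfl⟩ : ∃ j, i = j + 1 := ⟨i - 1, by omega⟩
  rw [if_pos (show 1 ≤ j + 1 by omega)]
  simp only [Nat.add_sub_cancel]
  have hd1 : 1 ≤ d := by omega
  have h10 : ww B 1 = 1 := by rw [ww]
  have hφ1 : φ 1 = φp 1 - S 1 * (ww B d * R d) := by
    have h1 := hφ 1 le_rfl hd1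
    have h2 := hy 0 1 (by omega)
    have h3 := hx 0 d (by omega)
    have h4 : θ 0 - θ d ≠ 0 := sub_ne_zero.mpr (hdist _ _ (by omega) (by omega) (by omega)).1
    simp only [sum_range_one, Nat.sub_zero, Nat.sub_self, mul_zero, zero_add, h10, div_self h4] at h1 h2 h3
    rw [h1, h2, ← h3]; ring
  have hwd : ww B d ≠ 0 := left_ne_zero_of_mul (hwS 0 d (by omega) hd1)
  have hyj : θs (j+1) - θs j = S (2*j+1) := by
    rw [hy j 1 (by omega), h10, one_mul]
  have hxi : θ (j+1) - θ 0 = ww B (j+1) * R (j+1) := by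
    have := hx 0 (j+1) (by omega)
    simpa using this
  have hyi : θs (j+1) - θs 0 = ww B (j+1) * S (j+1) := by
    have := hy 0 (j+1) (by omega)
    simpa using this
  have n3 : S (2*j+1) ≠ 0 := right_ne_zero_of_mul (hwS j 1 (by omega) le_rfl)
  obtain ⟨m, hm⟩ : ∃ m, d = j + 1 + m := ⟨d - (j+1), by omega⟩
  have hpi : φ (j+1) = φp 1 / ww B d * (if Odd m then TT B (j+1) else 1) * ww B (j+1) * ww B (m+1)
      - ww B (j+1) * S (j+1) * (ww B (m+1) * R (2*j+1+m)) := by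
    have h1 := hφ (j+1) (by omega) (by omega)
    have h2 := hx j (m+1) (by omega)
    rw [show j + (m+1) = d by omega, show 2*j+(m+1) = 2*j+1+m by ring] at h2
    rw [h1, hth (j+1) m (by omega) hd1, hyi, Nat.add_sub_cancel, ← neg_sub (θ d), h2]
    ring
  have hppi : φp (j+1) = (φp 1 / ww B d - S 1 * R d) * (if Odd m then TT B (j+1) else 1) * ww B (j+1) * ww B (m+1)
      + ww B (j+1) * S (j+1) * (ww B (m+1) * R (m+1)) := by
    have h1 := hφp (j+1) (by omega) (by omega)
    have h2 := hx 0 (m+1) (by omega)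
    simp only [mul_zero, zero_add] at h2
    rw [h1, hth (j+1) m (by omega) hd1, hyi, show d - (j+1) + 1 = m + 1 by omega, h2, hφ1]
    field_simp
  rcases Nat.eq_zero_or_pos m with rfl | hm0
  · rw [if_neg (by omega)]
    have hdj : d = j + 1 := by omega
    have hφz : φ (j+1+1) = 0 := by rw [← hdj]; exact hφd1
    rw [hφz, zero_div, hdj, Icc_self, prod_singleton, Icc_eq_empty (by omega), prod_empty]
    rw [← neg_sub (θs (j+1)) (θs j), hyj]
    have g1 := (up_both B S hS j j).1 (by simp [Nat.even_add])
    have g2 := (down_both B S hS j 1).1 odd_one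
    have g3 := hS j
    have g1' := (up_both B R hR j j).1 (by simp [Nat.even_add])
    have g2' := (down_both B R hR j 1).1 odd_one
    have g3' := hR j
    rw [show j + 1 + j = 2*j+1 by ring] at g1 g1'
    rw [show 1 + j = j + 1 by ring, show j+1+1 = j+2 by ring] at g2 g2'
    have hz : ¬ Odd 0 := by simp
    simp only [hz, if_false, zero_add, h10, mul_one, add_zero, one_mul] at hpi hppi hm
    rw [hm] at hppi hpi
    have : R (j+1) * (S (2*j+1) + S 1) = S (j+1) * (R (2*j+1) + R 1) := by
      rw [g1, g2, g1', g2', g3, g3']; ring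
    have e : φ (j+1) - φp (j+1) = - (θ (j+1) - θ 0) * S (2*j+1) := by
      rw [hpi, hppi, hxi]
      linear_combination ww B (j+1) * this
    have e2 : (φ (j+1) - φp (j+1)) / S (2*j+1) = - (θ (j+1) - θ 0) := by
      rw [e]; field_simp
    rw [sub_div] at e2
    rw [div_neg, mul_one]
    linear_combination e2
  · rw [if_pos (by omega)]
    have hyp : θs (j+1+1) - θs (j+1) = S (2*j+3) := by
      rw [hy (j+1) 1 (by omega), h10, one_mul, show 2*(j+1)+1 = 2*j+3 by ring]
    have n5 : S (2*j+3) ≠ 0 := by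
      have := right_ne_zero_of_mul (hwS (j+1) 1 (by omega) le_rfl)
      rwa [show 2*(j+1)+1 = 2*j+3 by ring] at this
    have n4 : S (2*j+2) ≠ 0 := right_ne_zero_of_mul (hwS j 2 (by omega) (by omega))
    have n1 : ww B (j+2) ≠ 0 := left_ne_zero_of_mul (hwS 0 (j+2) (by omega) (by omega))
    have n2 : ww B (m+1) ≠ 0 := left_ne_zero_of_mul (hwS 0 (m+1) (by omega) (by omega))
    have hpi1 : φ (j+2) = φp 1 / ww B d * (if Even m then TT B (j+2) else 1) * ww B (j+2) * ww B m
      - ww B (j+2) * S (j+2) * (ww B m * R (2*j+2+m)) := by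
      have h1 := hφ (j+2) (by omega) (by omega)
      have h2 := hx (j+1) m (by omega)
      have h3 := hy 0 (j+2) (by omega)
      simp only [mul_zero, zero_add] at h3
      have h4 := hth (j+2) (m-1) (by omega) hd1
      have h5 : Odd (m-1) ↔ Even m := by simp only [Nat.even_iff, Nat.odd_iff]; omega
      rw [show m - 1 + 1 = m by omega] at h4
      simp only [h5] at h4
      rw [← hm, show 2*(j+1)+m = 2*j+2+m by ring] at h2
      rw [h1, h4, h3, show j + 2 - 1 = j + 1 by omega, ← neg_sub (θ d), h2]
      ring
    have hP : (∏ h ∈ range (j+1), (θs (j+1) - θs h)) / (∏ h ∈ range (j+1+1), (θs (j+1+1) - θs h))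
        = S (j+1) / (ww B (j+2) * S (2*j+2) * S (2*j+3)) := by
      have q := prodP B S (j+1) (j+1) le_rfl
      have q1 : ∏ h ∈ range (j+1), (θs (j+1) - θs h) = ∏ h ∈ range (j+1), (ww B (j+1-h) * S (j+1+h)) := by
        apply prod_congr rfl
        intro h hh
        rw [mem_range] at hh
        have := hy h (j+1-h) (by omega)
        rw [show h + (j+1-h) = j+1 by omega, show 2*h+(j+1-h) = j+1+h by omega] at this
        exact this
      have q2 : ∏ h ∈ range (j+1), (θs (j+1+1) - θs h) = ∏ h ∈ range (j+1), (ww B (j+1+1-h) * S (j+1+1+h)) := by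
        apply prod_congr rfl
        intro h hh
        rw [mem_range] at hh
        have := hy h (j+1+1-h) (by omega)
        rw [show h + (j+1+1-h) = j+1+1 by omega, show 2*h+(j+1+1-h) = j+1+1+h by omega] at this
        exact this
      have q3 : ∏ h ∈ range (j+1), (θs (j+1+1) - θs h) ≠ 0 := by
        rw [prod_ne_zero_iff]
        intro h hh
        rw [mem_range] at hh
        exact sub_ne_zero.mpr (hdist _ _ (by omega) (by omega) (by omega)).2
      rw [← q1, ← q2, show j+1+(j+1) = 2*j+2 by ring, show j+1+1-(j+1) = 1 by omega, h10] at q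
      rw [prod_range_succ _ (j+1), hyp, div_eq_div_iff (mul_ne_zero q3 n5) (mul_ne_zero (mul_ne_zero n1 n4) n5)]
      linear_combination S (2*j+3) * q
    have hQ : (∏ h ∈ Icc (j+1+1) d, (θs (j+1) - θs h)) / (∏ h ∈ Icc (j+1) d, (θs j - θs h))
        = - (S (2*j+2+m) / (ww B (m+1) * S (2*j+2) * S (2*j+1))) := by
      have q := prodQ B S (2*j+2) m
      have ic : ∀ g : ℕ → K, ∏ h ∈ Icc (j+1+1) d, g h = ∏ k ∈ range m, g (j+2+k) := by
        intro g
        rw [← Finset.Ico_add_one_right_eq_Icc, prod_Ico_eq_prod_range, show d + 1 - (j+1+1) = m by omega]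
      have q1 : ∏ h ∈ Icc (j+1+1) d, (θs (j+1) - θs h) = (-1)^m * ∏ k ∈ range m, (ww B (k+1) * S (2*j+2+1+k)) := by
        rw [ic]
        have : (-1:K)^m = ∏ k ∈ range m, (-1:K) := by simp
        rw [this, ← prod_mul_distrib]
        apply prod_congr rfl
        intro h hh
        rw [mem_range] at hh
        have := hy (j+1) (h+1) (by omega)
        rw [show j+1+(h+1) = j+2+h by omega, show 2*(j+1)+(h+1) = 2*j+2+1+h by omega] at this
        rw [← this]; ring
      have q2 : ∏ h ∈ Icc (j+1+1) d, (θs j - θs h) = (-1)^m * ∏ k ∈ range m, (ww B (k+2) * S (2*j+2+k)) := by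
        rw [ic]
        have : (-1:K)^m = ∏ k ∈ range m, (-1:K) := by simp
        rw [this, ← prod_mul_distrib]
        apply prod_congr rfl
        intro h hh
        rw [mem_range] at hh
        have := hy j (h+2) (by omega)
        rw [show j+(h+2) = j+2+h by omega, show 2*j+(h+2) = 2*j+2+h by omega] at this
        rw [← this]; ring
      have q3 : ∏ h ∈ Icc (j+1+1) d, (θs j - θs h) ≠ 0 := by
        rw [prod_ne_zero_iff]
        intro h hh
        rw [mem_Icc] at hh
        exact sub_ne_zero.mpr (hdist _ _ (by omega) (by omega) (by omega)).2
      have q4 : ∏ h ∈ Icc (j+1) d, (θs j - θs h) = - S (2*j+1) * ∏ h ∈ Icc (j+1+1) d, (θs j - θs h) := by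
        rw [← hyj, ← Finset.insert_Icc_add_one_left_eq_Icc (by omega : j+1 ≤ d), prod_insert (by simp)]
        ring
      rw [q4, ← neg_div, div_eq_div_iff (mul_ne_zero (neg_ne_zero.mpr n3) q3) (mul_ne_zero (mul_ne_zero n2 n4) n3), q1, q2]
      linear_combination (-1)^m * S (2*j+1) * q
    have o1 := oneP B S hS (j+1)
    rw [show 2*(j+1) = 2*j+2 by ring, show 2*j+2+1 = 2*j+3 by ring] at o1
    have o2 := oneQ B S hS j m
    have hk := key B S hS R hR j m
    rw [← hm] at hk
    have hc : (if Odd m then TT B (j+1) else 1) * TT B m = (if Even m then TT B (j+2) else 1) * TT B (j+1) := by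
      rcases Nat.even_or_odd m with h | h
      · rw [if_neg (by simpa using h), if_pos h, TT_even B h]
        rcases Nat.even_or_odd j with h' | h'
        · rw [TT_odd B h'.add_one, TT_even B (by simpa [Nat.even_add] using h')]; ring
        · rw [TT_even B h'.add_one, TT_odd B (by revert h'; simp only [Nat.odd_iff]; omega)]
      · rw [if_pos h, if_neg (by simpa using h), TT_odd B h]; ring
    have fin := mid_alg (φp 1 / ww B d) _ _ _ _ _ _ _ _ _ _ _ _ _ _ _ _ _ _ _ _ _ _ _ o1 o2 hc hk hpi hpi1 hppi n1 n2 n3 n4 n5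
    rw [mul_div_assoc, mul_div_assoc, hP, hQ, hyj, ← neg_sub (θs (j+1+1)), hyp, div_neg]
    rw [show j + 1 + 1 = j + 2 by ring]
    linear_combination fin + hxi
end
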